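/- arXiv:1307.1565 — 3 statements merged into one kernel-verified Lean document; each statement's English description precedes it below -/
import Mathlib

section
/- Let D₀, V₀ be p×p symmetric positive definite matrices with 𝔞²D₀² ⪰ V₀², let ε ∈ (0,1/2), r ≤ r₀, δ = δ₀εr, ϱ = 3ν₀ω₀εr, and set D_ϱ² = D₀²(1−δ) − ϱV₀², D_{−}² = D₀²(1+δ) + ϱV₀². Let w ∈ ℝᵖ and put ξ = D₀⁻¹w, ξ_ϱ = D_ϱ⁻¹w, ξ_{−} = D_{−}⁻¹w. If τ := εr₀(δ₀ + 3ν₀ω₀𝔞²) < 1, then ‖ξ_ϱ‖² − ‖ξ‖² ≤ (τ/(1−τ))‖ξ‖² and ‖ξ‖² − ‖ξ_{−}‖² ≤ (τ/(1+τ))‖ξ‖². -/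
open MeasureTheory Real
open scoped RealInnerProductSpace

/-- Application of a `p × p` real matrix to a vector in Euclidean space. -/
noncomputable def mApp {p : ℕ} (A : Matrix (Fin p) (Fin p) ℝ)
    (v : EuclideanSpace ℝ (Fin p)) : EuclideanSpace ℝ (Fin p) :=
  Matrix.toEuclideanLin A v

open Matrix in
lemma aux_norm {p : ℕ} (A : Matrix (Fin p) (Fin p) ℝ) (x : EuclideanSpace ℝ (Fin p)) :
    ‖mApp A x‖ ^ 2 = (A *ᵥ x.ofLp) ⬝ᵥ (A *ᵥ x.ofLp) := by
  rw [EuclideanSpace.real_norm_sq_eq]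
  simp [mApp, dotProduct, sq, Matrix.toLpLin_apply]

open Matrix in
lemma aux_sq {p : ℕ} {A : Matrix (Fin p) (Fin p) ℝ} (hA : A.PosDef) (x : Fin p → ℝ) :
    (A *ᵥ x) ⬝ᵥ (A *ᵥ x) = x ⬝ᵥ ((A ^ 2) *ᵥ x) := by
  have hT : Aᵀ = A := by have := hA.isHermitian; rwa [Matrix.IsHermitian, Matrix.conjTranspose_eq_transpose_of_trivial] at this
  rw [sq, ← Matrix.mulVec_mulVec, Matrix.dotProduct_mulVec x, ← Matrix.mulVec_transpose, hT]

open Matrix in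
lemma aux_key {p : ℕ} {A B : Matrix (Fin p) (Fin p) ℝ} (hA : A.PosDef) (hB : B.PosDef)
    (c : ℝ) (hc : 0 < c)
    (h : ∀ x : Fin p → ℝ, c * (x ⬝ᵥ ((A ^ 2) *ᵥ x)) ≤ x ⬝ᵥ ((B ^ 2) *ᵥ x))
    (w : EuclideanSpace ℝ (Fin p)) :
    c * ‖mApp B⁻¹ w‖ ^ 2 ≤ ‖mApp A⁻¹ w‖ ^ 2 := by
  rw [aux_norm, aux_norm]
  generalize w.ofLp = v
  have hAT : Aᵀ = A := by have := hA.isHermitian; rwa [Matrix.IsHermitian, Matrix.conjTranspose_eq_transpose_of_trivial] at this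
  have hBT : Bᵀ = B := by have := hB.isHermitian; rwa [Matrix.IsHermitian, Matrix.conjTranspose_eq_transpose_of_trivial] at this
  have hAu : IsUnit A.det := (Matrix.isUnit_iff_isUnit_det A).1 hA.isUnit
  have hBu : IsUnit B.det := (Matrix.isUnit_iff_isUnit_det B).1 hB.isUnit
  set b := B⁻¹ *ᵥ v with hb
  set u := A⁻¹ *ᵥ v with hu
  set y := B⁻¹ *ᵥ b with hy
  have hBy : B *ᵥ y = b := by
    rw [hy, Matrix.mulVec_mulVec, Matrix.mul_nonsing_inv _ hBu, Matrix.one_mulVec]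
  have hBb : B *ᵥ b = v := by
    rw [hb, Matrix.mulVec_mulVec, Matrix.mul_nonsing_inv _ hBu, Matrix.one_mulVec]
  have hAuv : A *ᵥ u = v := by
    rw [hu, Matrix.mulVec_mulVec, Matrix.mul_nonsing_inv _ hAu, Matrix.one_mulVec]
  clear_value y u b
  have h1 : b ⬝ᵥ b = u ⬝ᵥ (A *ᵥ y) := by
    rw [Matrix.dotProduct_mulVec, ← Matrix.mulVec_transpose, hAT, hAuv]
    nth_rewrite 2 [← hBy]
    rw [Matrix.dotProduct_mulVec, ← Matrix.mulVec_transpose, hBT, hBb]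
  have h2 := h y
  rw [← aux_sq hA, ← aux_sq hB, hBy] at h2
  -- the square of `u - c A y` is nonnegative
  have h3 : 0 ≤ (u - c • (A *ᵥ y)) ⬝ᵥ (u - c • (A *ᵥ y)) := by
    exact Finset.sum_nonneg fun i _ => mul_self_nonneg _
  simp only [sub_dotProduct, dotProduct_sub, smul_dotProduct, dotProduct_smul, smul_eq_mul] at h3
  rw [dotProduct_comm (A *ᵥ y) u, ← h1] at h3
  nlinarith

/-- Lemma `Lxivgap`: with `D₀, V₀` symmetric positive definite,
`𝔞²D₀² ⪰ V₀²`, `ε ∈ (0,1/2)`, `r ≤ r₀`, `δ = δ₀εr`, `ϱ = 3ν₀ω₀εr`,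
`D_ϱ² = (1-δ)D₀² - ϱV₀²`, `D_-² = (1+δ)D₀² + ϱV₀²`, and `ξ = D₀⁻¹w`, `ξ_ϱ = D_ϱ⁻¹w`,
`ξ_- = D_-⁻¹w`: if `τ = εr₀(δ₀ + 3ν₀ω₀𝔞²) < 1` then
`‖ξ_ϱ‖² - ‖ξ‖² ≤ (τ/(1-τ))‖ξ‖²` and `‖ξ‖² - ‖ξ_-‖² ≤ (τ/(1+τ))‖ξ‖²`. -/
theorem stmt4 {p : ℕ} (D₀ V₀ : Matrix (Fin p) (Fin p) ℝ)
    (hD₀ : D₀.PosDef) (hV₀ : V₀.PosDef)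
    (a ε r r₀ δ₀ ν₀ ω₀ : ℝ)
    (hdom : (a ^ 2 • D₀ ^ 2 - V₀ ^ 2).PosSemidef)
    (hε : ε ∈ Set.Ioo (0 : ℝ) (1 / 2)) (hr : 0 < r) (hrr₀ : r ≤ r₀)
    (hδ₀ : 0 < δ₀) (hν₀ : 0 < ν₀) (hω₀ : 0 < ω₀)
    (δ ϱ : ℝ) (hδ : δ = δ₀ * ε * r) (hϱ : ϱ = 3 * ν₀ * ω₀ * ε * r)
    (Dρ Dm : Matrix (Fin p) (Fin p) ℝ)
    (hDρ : Dρ ^ 2 = (1 - δ) • D₀ ^ 2 - ϱ • V₀ ^ 2) (hDρpos : Dρ.PosDef)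
    (hDm : Dm ^ 2 = (1 + δ) • D₀ ^ 2 + ϱ • V₀ ^ 2) (hDmpos : Dm.PosDef)
    (w : EuclideanSpace ℝ (Fin p))
    (τ : ℝ) (hτ : τ = ε * r₀ * (δ₀ + 3 * ν₀ * ω₀ * a ^ 2)) (hτ1 : τ < 1) :
    ‖mApp Dρ⁻¹ w‖ ^ 2 - ‖mApp D₀⁻¹ w‖ ^ 2 ≤ τ / (1 - τ) * ‖mApp D₀⁻¹ w‖ ^ 2 ∧
      ‖mApp D₀⁻¹ w‖ ^ 2 - ‖mApp Dm⁻¹ w‖ ^ 2 ≤ τ / (1 + τ) * ‖mApp D₀⁻¹ w‖ ^ 2 := by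
  obtain ⟨hε0, _⟩ := hε
  have hδ0 : 0 ≤ δ := by rw [hδ]; positivity
  have hϱ0 : 0 ≤ ϱ := by rw [hϱ]; positivity
  have hτ' : δ + ϱ * a ^ 2 ≤ τ := by
    have : δ + ϱ * a ^ 2 = ε * r * (δ₀ + 3 * ν₀ * ω₀ * a ^ 2) := by rw [hδ, hϱ]; ring
    rw [this, hτ]
    gcongr
  have hτ0 : 0 ≤ τ := le_trans (by positivity) hτ'
  have hd : ∀ x : Fin p → ℝ, x ⬝ᵥ ((V₀ ^ 2).mulVec x) ≤ a ^ 2 * (x ⬝ᵥ ((D₀ ^ 2).mulVec x)) := by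
    intro x
    have := hdom.dotProduct_mulVec_nonneg x
    simp only [star_trivial, Matrix.sub_mulVec, Matrix.smul_mulVec, dotProduct_sub,
      dotProduct_smul, smul_eq_mul] at this
    linarith
  have hD0 : ∀ x : Fin p → ℝ, 0 ≤ x ⬝ᵥ ((D₀ ^ 2).mulVec x) := by
    intro x
    rw [← aux_sq hD₀]
    exact Finset.sum_nonneg fun i _ => mul_self_nonneg _
  have e1 := aux_key hD₀ hDρpos (1 - τ) (by linarith) (by
    intro x
    rw [hDρ]
    simp only [Matrix.sub_mulVec, Matrix.smul_mulVec, dotProduct_sub,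
      dotProduct_smul, smul_eq_mul]
    nlinarith [mul_le_mul_of_nonneg_left (hd x) hϱ0, mul_le_mul_of_nonneg_right hτ' (hD0 x)]) w
  have e2 := aux_key hDmpos hD₀ (1 / (1 + τ)) (by positivity) (by
    intro x
    rw [hDm, one_div, inv_mul_le_iff₀ (by positivity)]
    simp only [Matrix.add_mulVec, Matrix.smul_mulVec, dotProduct_add,
      dotProduct_smul, smul_eq_mul]
    nlinarith [mul_le_mul_of_nonneg_left (hd x) hϱ0, mul_le_mul_of_nonneg_right hτ' (hD0 x)]) w
  constructor
  · have h1 : 0 < 1 - τ := by linarith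
    rw [div_mul_eq_mul_div, le_div_iff₀ h1]
    nlinarith
  · have h1 : 0 < 1 + τ := by linarith
    have : τ / (1 + τ) = 1 - 1 / (1 + τ) := by field_simp; ring
    rw [this]
    linarith
end

section
/- Let ξ be a random vector in ℝᵖ with log 𝔼 exp(γᵀξ) ≤ ‖γ‖²/2 for all γ ∈ ℝᵖ with ‖γ‖ ≤ g, and let B be a symmetric p×p matrix with λ_max(B²) = 1. Then for each y ≥ y_c: P( ‖Bξ‖ > y ) ≤ 8.4 · exp( −x_c − γ_c(y − y_c)/2 ), where γ_c = g − √(μ_c 𝚙) = g·w_c/(1+w_c). -/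
open MeasureTheory Real
open scoped RealInnerProductSpace

open ProbabilityTheory in
lemma aux_moments (c : ℝ) :
    (∫ x, x ^ 2 ∂(gaussianReal c 1) = 1 + c ^ 2) ∧
    (∫ x, x ^ 4 ∂(gaussianReal c 1) = c ^ 4 + 6 * c ^ 2 + 3) := by
  have h0 : (0 : ℝ) ∈ interior (integrableExpSet (fun x : ℝ => x) (gaussianReal c 1)) := by
    simp
  have h2 := iteratedDeriv_mgf_zero h0 2
  have h4 := iteratedDeriv_mgf_zero h0 4
  have key : ∀ (Q Q' : ℝ → ℝ), (∀ t, HasDerivAt Q (Q' t) t) →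
      deriv (fun t => Q t * Real.exp (c * t + t ^ 2 / 2)) =
      fun t => (Q' t + Q t * (c + t)) * Real.exp (c * t + t ^ 2 / 2) := by
    intro Q Q' hQ
    funext t
    have he : HasDerivAt (fun t : ℝ => Real.exp (c * t + t ^ 2 / 2))
        (Real.exp (c * t + t ^ 2 / 2) * (c + t)) t := by
      apply HasDerivAt.exp
      have := ((hasDerivAt_id t).const_mul c).add (((hasDerivAt_id t).pow 2).div_const 2)
      convert! this using 1
      simp
    have := ((hQ t).mul he).deriv
    rw [show (fun t => Q t * Real.exp (c * t + t ^ 2 / 2)) = Q * (fun t : ℝ => Real.exp (c * t + t ^ 2 / 2)) from rfl, this]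
    ring
  have e0 : mgf (fun x : ℝ => x) (gaussianReal c 1) =
      fun t => (1 : ℝ) * Real.exp (c * t + t ^ 2 / 2) := by
    rw [mgf_fun_id_gaussianReal]; funext t; simp
  have e1 := key (fun _ => 1) (fun _ => 0) (fun t => hasDerivAt_const t 1)
  have e2 := key (fun t => 0 + 1 * (c + t)) (fun _ => 1) (fun t => by
    have := ((hasDerivAt_id t).const_add c)
    simpa using this)
  have hd : ∀ t : ℝ, HasDerivAt (fun t => c + t) 1 t := fun t => by
    simpa using ((hasDerivAt_id t).const_add c)
  have e3 := key (fun t => 1 + (0 + 1 * (c + t)) * (c + t)) (fun t => 2 * (c + t)) (fun t => by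
    have := ((hd t).mul (hd t)).const_add 1
    convert! this using 1
    · funext s; simp
    · simp; ring)
  have e4 := key (fun t => 2 * (c + t) + (1 + (0 + 1 * (c + t)) * (c + t)) * (c + t))
    (fun t => 3 + 3 * (c + t) ^ 2) (fun t => by
    have := ((hd t).const_mul 3).add (((hd t).mul (hd t)).mul (hd t))
    convert! this using 1
    · funext s; simp; ring
    · simp; ring)
  constructor
  · rw [iteratedDeriv_succ, iteratedDeriv_one, e0, e1, e2] at h2
    simp at h2
    rw [← h2]; ring
  · rw [iteratedDeriv_succ, iteratedDeriv_succ, iteratedDeriv_succ, iteratedDeriv_one, e0, e1, e2,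
      e3, e4] at h4
    simp at h4
    rw [← h4]; ring

open ProbabilityTheory in
lemma aux_var (c : ℝ) : MemLp (fun x : ℝ => x ^ 2) 2 (gaussianReal c 1) ∧
    Var[fun x : ℝ => x ^ 2; gaussianReal c 1] = 2 + 4 * c ^ 2 := by
  have hint4 : Integrable (fun x : ℝ => x ^ 4) (gaussianReal c 1) := by
    have := (memLp_id_gaussianReal (μ := c) (v := 1) 4).integrable_norm_pow (p := 4) (by norm_num)
    refine this.congr (Filter.Eventually.of_forall fun x => ?_)
    simp [Even.pow_abs (by decide : Even 4)]
  have hm : MemLp (fun x : ℝ => x ^ 2) 2 (gaussianReal c 1) := by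
    rw [memLp_two_iff_integrable_sq (by fun_prop)]
    refine hint4.congr (Filter.Eventually.of_forall fun x => ?_)
    simp only; ring
  refine ⟨hm, ?_⟩
  rw [variance_eq_sub hm]
  have : (fun x : ℝ => x ^ 2) ^ 2 = fun x : ℝ => x ^ 4 := by
    funext x; simp only [Pi.pow_apply]; ring
  rw [this, (aux_moments c).1, (aux_moments c).2]
  ring

open ProbabilityTheory in
lemma aux_tilt1 (c : ℝ) : gaussianReal c 1 =
    (gaussianReal 0 1).withDensity (fun x => ENNReal.ofReal (Real.exp (c * x - c ^ 2 / 2))) := by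
  rw [gaussianReal_of_var_ne_zero _ (by norm_num), gaussianReal_of_var_ne_zero _ (by norm_num)]
  rw [← withDensity_mul _ (measurable_gaussianPDF _ _) (by fun_prop)]
  congr 1
  funext x
  simp only [Pi.mul_apply, gaussianPDF]
  rw [← ENNReal.ofReal_mul (gaussianPDFReal_nonneg _ _ _)]
  congr 1
  simp only [gaussianPDFReal]
  rw [mul_assoc _ (Real.exp _) (Real.exp _), ← Real.exp_add]
  congr 2
  simp
  ring

open ProbabilityTheory in
lemma aux_lprod {p : ℕ} (m : Fin p → Measure ℝ) [∀ i, IsProbabilityMeasure (m i)]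
    (f : Fin p → ℝ → ENNReal) (hf : ∀ i, Measurable (f i)) :
    ∫⁻ e, ∏ i, f i (e i) ∂(Measure.pi m) = ∏ i, ∫⁻ x, f i x ∂(m i) := by
  rw [lintegral_prod_eq_prod_lintegral_of_indepFun (μ := Measure.pi m) Finset.univ
    (fun i (e : Fin p → ℝ) => f i (e i))
    (iIndepFun_pi fun i => (hf i).aemeasurable) (fun i => (hf i).comp (measurable_pi_apply i))]
  refine Finset.prod_congr rfl fun i _ => ?_
  exact (measurePreserving_eval m i).lintegral_comp (hf i)

open ProbabilityTheory in
lemma aux_tilt {p : ℕ} (c : Fin p → ℝ) :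
    Measure.pi (fun i => gaussianReal (c i) 1) =
    (Measure.pi (fun _ : Fin p => gaussianReal 0 1)).withDensity
      (fun e => ∏ i, ENNReal.ofReal (Real.exp (c i * e i - (c i) ^ 2 / 2))) := by
  apply Measure.pi_eq
  intro s hs
  rw [withDensity_apply _ (MeasurableSet.univ_pi hs), ← lintegral_indicator (MeasurableSet.univ_pi hs)]
  have : ∀ e : Fin p → ℝ, (Set.univ.pi s).indicator
      (fun e => ∏ i, ENNReal.ofReal (Real.exp (c i * e i - (c i) ^ 2 / 2))) e =
      ∏ i, (s i).indicator (fun x => ENNReal.ofReal (Real.exp (c i * x - (c i) ^ 2 / 2))) (e i) := by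
    intro e
    by_cases he : e ∈ Set.univ.pi s
    · rw [Set.indicator_of_mem he]
      refine Finset.prod_congr rfl fun i _ => ?_
      rw [Set.indicator_of_mem (he i (Set.mem_univ i))]
    · rw [Set.indicator_of_notMem he]
      simp only [Set.mem_univ_pi, not_forall] at he
      obtain ⟨i, hi⟩ := he
      exact (Finset.prod_eq_zero (Finset.mem_univ i) (Set.indicator_of_notMem hi _)).symm
  simp_rw [this]
  rw [aux_lprod (fun _ => gaussianReal 0 1) (fun i => (s i).indicator
    (fun x => ENNReal.ofReal (Real.exp (c i * x - (c i) ^ 2 / 2))))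
    (fun i => Measurable.indicator (by fun_prop) (hs i))]
  refine Finset.prod_congr rfl fun i _ => ?_
  rw [lintegral_indicator (hs i), ← withDensity_apply _ (hs i), ← aux_tilt1]

open ProbabilityTheory in
lemma aux_gauss (t : ℝ) (ht : t < 1) :
    ∫⁻ x, ENNReal.ofReal (Real.exp (t * x ^ 2 / 2)) ∂(gaussianReal 0 1) =
      ENNReal.ofReal (Real.exp (-Real.log (1 - t) / 2)) := by
  rw [gaussianReal_of_var_ne_zero _ (by norm_num),
    lintegral_withDensity_eq_lintegral_mul _ (measurable_gaussianPDF _ _) (by fun_prop)]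
  have : ∀ x : ℝ, (gaussianPDF 0 1 * fun x => ENNReal.ofReal (Real.exp (t * x ^ 2 / 2))) x =
      ENNReal.ofReal ((√(2 * π))⁻¹ * Real.exp (-((1 - t) / 2) * x ^ 2)) := by
    intro x
    simp only [Pi.mul_apply, gaussianPDF]
    rw [← ENNReal.ofReal_mul (gaussianPDFReal_nonneg _ _ _)]
    congr 1
    simp only [gaussianPDFReal]
    rw [mul_assoc _ (Real.exp _) (Real.exp _), ← Real.exp_add]
    congr 2
    · simp
    · simp
      ring
  simp_rw [this]
  rw [← ofReal_integral_eq_lintegral_ofReal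
    ((integrable_exp_neg_mul_sq (by linarith)).const_mul _)
    (Filter.Eventually.of_forall fun x => by positivity), integral_const_mul, integral_gaussian]
  congr 1
  have h1 : 0 < 1 - t := by linarith
  have : π / ((1 - t) / 2) = (2 * π) / (1 - t) := by field_simp
  rw [this, Real.sqrt_div (by positivity), ← mul_div_assoc, inv_mul_cancel₀ (by positivity)]
  rw [neg_div, Real.exp_neg, Real.exp_half, Real.exp_log h1, one_div]

open ProbabilityTheory in
lemma aux_cantelli {Ω : Type*} [MeasurableSpace Ω] (ν : Measure Ω) [IsProbabilityMeasure ν]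
    (V : Ω → ℝ) (hV : Measurable V) (hV2 : MemLp V 2 ν) (m s τ : ℝ) (hm : ∫ ω, V ω ∂ν ≤ m)
    (hs : Var[V; ν] ≤ s) (hτ : 0 < τ) :
    ENNReal.ofReal (τ ^ 2 / (s + τ ^ 2)) ≤ ν {ω | V ω ≤ m + τ} := by
  have hs0 : 0 ≤ s := (variance_nonneg V ν).trans hs
  set E := ∫ ω, V ω ∂ν with hE
  set h := s / τ with hh
  have hh0 : 0 ≤ h := by positivity
  have hVE : MemLp (fun ω => V ω - E) 2 ν := hV2.sub (memLp_const E)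
  have hi1 : Integrable (fun ω => V ω - E) ν := hVE.integrable (by norm_num)
  have hi2 : Integrable (fun ω => (V ω - E) ^ 2) ν := hVE.integrable_sq
  have hint : Integrable (fun ω => (V ω - E + h) ^ 2) ν := by
    exact (hVE.add (memLp_const h)).integrable_sq
  have hval : ∫ ω, (V ω - E + h) ^ 2 ∂ν ≤ s + h ^ 2 := by
    have e1 : ∀ ω, (V ω - E + h) ^ 2 = (V ω - E) ^ 2 + (2 * h) * (V ω - E) + h ^ 2 := by
      intro ω; ring
    simp_rw [e1]
    have hi3 : Integrable (fun ω => (V ω - E) ^ 2 + (2 * h) * (V ω - E)) ν :=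
      hi2.add (hi1.const_mul _)
    rw [integral_add hi3 (integrable_const _),
      integral_add hi2 (hi1.const_mul _), integral_const_mul,
      integral_sub (hV2.integrable (by norm_num)) (integrable_const _)]
    rw [variance_eq_integral hV.aemeasurable] at hs
    simp
    linarith
  have hmk := mul_meas_ge_le_integral_of_nonneg (μ := ν) (f := fun ω => (V ω - E + h) ^ 2)
    (Filter.Eventually.of_forall fun ω => by positivity) hint ((τ + h) ^ 2)
  have hcomp : {ω | V ω ≤ m + τ}ᶜ ⊆ {ω | (τ + h) ^ 2 ≤ (V ω - E + h) ^ 2} := by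
    intro ω hω
    simp only [Set.mem_compl_iff, Set.mem_ofPred_eq, not_le] at hω ⊢
    apply pow_le_pow_left₀ (by positivity)
    linarith
  have hms : MeasurableSet {ω | V ω ≤ m + τ} := hV measurableSet_Iic
  have hle : ν.real {ω | V ω ≤ m + τ}ᶜ ≤ ν.real {ω | (τ + h) ^ 2 ≤ (V ω - E + h) ^ 2} :=
    measureReal_mono hcomp
  rw [probReal_compl_eq_one_sub hms] at hle
  rw [← ofReal_measureReal]
  apply ENNReal.ofReal_le_ofReal
  set q := ν.real {ω | V ω ≤ m + τ}
  have h3 : (τ + h) ^ 2 * (1 - q) ≤ s + h ^ 2 :=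
    (mul_le_mul_of_nonneg_left hle (by positivity)).trans (hmk.trans hval)
  have e2 : (τ + h) ^ 2 = (τ ^ 2 + s) ^ 2 / τ ^ 2 := by rw [hh]; field_simp
  have e3 : s + h ^ 2 = s * (τ ^ 2 + s) / τ ^ 2 := by rw [hh]; field_simp
  rw [e2, e3, div_mul_eq_mul_div, div_le_div_iff_of_pos_right (by positivity)] at h3
  have h4 : (τ ^ 2 + s) * (1 - q) ≤ s := by
    have : 0 < τ ^ 2 + s := by positivity
    nlinarith
  rw [div_le_iff₀ (by positivity)]
  linarith

open ProbabilityTheory in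
lemma aux_B {p : ℕ} (κ : Fin p → ℝ) (h0 : ∀ i, 0 ≤ κ i) (h1 : ∀ i, κ i ≤ 1)
    (hS : 1 ≤ ∑ i, κ i) (μ g a : ℝ) (hμ : 0 < μ) (ha : 0 < a) (c : Fin p → ℝ)
    (hc : ∑ i, c i ^ 2 = a ^ 2) (hg : μ * (a + √(∑ i, κ i)) ^ 2 ≤ g ^ 2) :
    ENNReal.ofReal (Real.exp (a ^ 2 / 2) / (2 + 1 / (2 * a ^ 2))) ≤
      ∫⁻ e, {e : Fin p → ℝ | μ * ∑ i, κ i * e i ^ 2 ≤ g ^ 2}.indicator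
        (fun e => ENNReal.ofReal (Real.exp (∑ i, c i * e i))) e
        ∂(Measure.pi (fun _ : Fin p => gaussianReal 0 1)) := by
  set A := {e : Fin p → ℝ | μ * ∑ i, κ i * e i ^ 2 ≤ g ^ 2} with hA
  have hAm : MeasurableSet A := measurableSet_le (by fun_prop) (by fun_prop)
  set S := ∑ i, κ i with hSdef
  set ν := Measure.pi (fun i => gaussianReal (c i) 1) with hν
  have hmain : ∫⁻ e, A.indicator
        (fun e => ENNReal.ofReal (Real.exp (∑ i, c i * e i))) e
        ∂(Measure.pi (fun _ : Fin p => gaussianReal 0 1)) =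
        ENNReal.ofReal (Real.exp (a ^ 2 / 2)) * ν A := by
    rw [hν, aux_tilt c, withDensity_apply _ hAm, ← lintegral_const_mul _ (by fun_prop),
      lintegral_indicator hAm]
    congr 1
    funext e
    rw [← ENNReal.ofReal_prod_of_nonneg (fun i _ => (Real.exp_pos _).le),
      ← ENNReal.ofReal_mul (Real.exp_pos _).le, ← Real.exp_sum, ← Real.exp_add,
      Finset.sum_sub_distrib, ← Finset.sum_div, hc]
    congr 2; ring
  rw [hmain]
  have hprob : ENNReal.ofReal (1 / (2 + 1 / (2 * a ^ 2))) ≤ ν A := by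
    set V : (Fin p → ℝ) → ℝ := ∑ i, fun e => κ i * e i ^ 2 with hV
    have hVapp : ∀ e, V e = ∑ i, κ i * e i ^ 2 := by intro e; simp [hV]
    have hmem : ∀ i, MemLp (fun x : ℝ => κ i * x ^ 2) 2 (gaussianReal (c i) 1) := fun i =>
      (aux_var (c i)).1.const_mul (κ i)
    have hvar : Var[V; ν] = ∑ i, κ i ^ 2 * (2 + 4 * c i ^ 2) := by
      rw [hV, hν, variance_sum_pi (μ := fun i => gaussianReal (c i) 1)
        (X := fun i x => κ i * x ^ 2) hmem]
      refine Finset.sum_congr rfl fun i _ => ?_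
      rw [variance_const_mul, (aux_var (c i)).2]
    have hmem' : ∀ i, MemLp (fun e : Fin p → ℝ => κ i * e i ^ 2) 2 ν := fun i =>
      (hmem i).comp_measurePreserving (measurePreserving_eval (fun i => gaussianReal (c i) 1) i)
    have hVmem : MemLp V 2 ν := memLp_finsetSum' _ fun i _ => hmem' i
    have hVmeas : Measurable V := by
      have : V = fun e => ∑ i, κ i * e i ^ 2 := funext hVapp
      rw [this]; fun_prop
    have hmean : ∫ e, V e ∂ν = ∑ i, κ i * (1 + c i ^ 2) := by
      simp_rw [hVapp]
      rw [integral_finsetSum _ fun i _ => (hmem' i).integrable (by norm_num)]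
      refine Finset.sum_congr rfl fun i _ => ?_
      have := integral_comp_eval (μ := fun i => gaussianReal (c i) 1) (i := i)
        (f := fun x : ℝ => κ i * x ^ 2) (by fun_prop)
      rw [hν, this, integral_const_mul, (aux_moments (c i)).1]
    have hmean' : ∫ e, V e ∂ν ≤ S + a ^ 2 := by
      rw [hmean, ← hc, hSdef, ← Finset.sum_add_distrib]
      refine Finset.sum_le_sum fun i _ => ?_
      nlinarith [h0 i, h1 i, sq_nonneg (c i)]
    have hvar' : Var[V; ν] ≤ 2 * S + 4 * a ^ 2 := by
      rw [hvar, ← hc, hSdef, Finset.mul_sum, Finset.mul_sum, ← Finset.sum_add_distrib]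
      refine Finset.sum_le_sum fun i _ => ?_
      have : κ i ^ 2 ≤ κ i := by nlinarith [h0 i, h1 i]
      have : κ i ^ 2 ≤ 1 := by nlinarith [h0 i, h1 i]
      nlinarith [sq_nonneg (c i)]
    have hS0 : 0 < S := by linarith
    have hτ : 0 < 2 * a * √S := by positivity
    have := aux_cantelli ν V hVmeas hVmem _ _ _ hmean' hvar' hτ
    refine le_trans (ENNReal.ofReal_le_ofReal ?_) (this.trans (measure_mono ?_))
    · have e : (2 * a * √S) ^ 2 = 4 * a ^ 2 * S := by
        rw [mul_pow, Real.sq_sqrt hS0.le]; ring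
      rw [e, div_le_div_iff₀ (by positivity) (by positivity)]
      have : (4 * a ^ 2 * S) * (2 + 1 / (2 * a ^ 2)) = 8 * a ^ 2 * S + 2 * S := by
        field_simp; ring
      rw [this]
      nlinarith [sq_nonneg a]
    · intro e he
      simp only [Set.mem_ofPred_eq, hVapp] at he
      simp only [hA, Set.mem_ofPred_eq]
      refine le_trans (mul_le_mul_of_nonneg_left he hμ.le) (le_trans (le_of_eq ?_) hg)
      rw [add_sq, Real.sq_sqrt hS0.le]; ring
  rw [div_eq_mul_one_div, ENNReal.ofReal_mul (Real.exp_pos _).le]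
  gcongr

open ProbabilityTheory in
lemma aux_A {Ω : Type*} [MeasurableSpace Ω] (P : Measure Ω) [IsProbabilityMeasure P]
    {p : ℕ} (κ : Fin p → ℝ) (h0 : ∀ i, 0 ≤ κ i) (h1 : ∀ i, κ i ≤ 1)
    (η : Ω → Fin p → ℝ) (hη : Measurable η) (g μ : ℝ) (hμ : 0 < μ) (hμ1 : μ < 1)
    (hm : ∀ b : Fin p → ℝ, ∑ i, b i ^ 2 ≤ g ^ 2 →
      ∫⁻ ω, ENNReal.ofReal (Real.exp (∑ i, b i * η ω i)) ∂P ≤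
        ENNReal.ofReal (Real.exp ((∑ i, b i ^ 2) / 2))) :
    ∫⁻ ω, ∫⁻ e, {e : Fin p → ℝ | μ * ∑ i, κ i * e i ^ 2 ≤ g ^ 2}.indicator
        (fun e => ENNReal.ofReal (Real.exp (∑ i, (√(μ * κ i) * η ω i) * e i))) e
        ∂(Measure.pi (fun _ : Fin p => gaussianReal 0 1)) ∂P ≤
      ENNReal.ofReal (Real.exp (-(∑ i, Real.log (1 - μ * κ i)) / 2)) := by
  set A := {e : Fin p → ℝ | μ * ∑ i, κ i * e i ^ 2 ≤ g ^ 2} with hA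
  have hAm : MeasurableSet A := measurableSet_le (by fun_prop) (by fun_prop)
  have hmeas : Measurable (fun z : Ω × (Fin p → ℝ) => A.indicator
        (fun e => ENNReal.ofReal (Real.exp (∑ i, (√(μ * κ i) * η z.1 i) * e i))) z.2) := by
    have : (fun z : Ω × (Fin p → ℝ) => A.indicator
        (fun e => ENNReal.ofReal (Real.exp (∑ i, (√(μ * κ i) * η z.1 i) * e i))) z.2) =
        (Prod.snd ⁻¹' A).indicator (fun z : Ω × (Fin p → ℝ) =>
          ENNReal.ofReal (Real.exp (∑ i, (√(μ * κ i) * η z.1 i) * z.2 i))) := by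
      funext z; rfl
    rw [this]
    exact Measurable.indicator (by fun_prop) (measurable_snd hAm)
  rw [lintegral_lintegral_swap hmeas.aemeasurable]
  calc _ ≤ ∫⁻ e, ∏ i, ENNReal.ofReal (Real.exp ((μ * κ i) * e i ^ 2 / 2))
        ∂(Measure.pi (fun _ : Fin p => gaussianReal 0 1)) := by
        refine lintegral_mono fun e => ?_
        have hsq : ∑ i, (√(μ * κ i) * e i) ^ 2 = μ * ∑ i, κ i * e i ^ 2 := by
          rw [Finset.mul_sum]
          refine Finset.sum_congr rfl fun i _ => ?_
          rw [mul_pow, Real.sq_sqrt (mul_nonneg hμ.le (h0 i))]; ring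
        by_cases he : e ∈ A
        · simp only [Set.indicator_of_mem he]
          have := hm (fun i => √(μ * κ i) * e i) (by rw [hsq]; exact he)
          rw [← ENNReal.ofReal_prod_of_nonneg (fun i _ => (Real.exp_pos _).le), ← Real.exp_sum]
          have e1 : ∀ ω, ∑ i, √(μ * κ i) * η ω i * e i = ∑ i, √(μ * κ i) * e i * η ω i := fun ω =>
            Finset.sum_congr rfl fun i _ => by ring
          have e2 : ∑ i, (μ * κ i) * e i ^ 2 / 2 = (∑ i, (√(μ * κ i) * e i) ^ 2) / 2 := by
            rw [hsq, Finset.mul_sum, Finset.sum_div]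
            exact Finset.sum_congr rfl fun i _ => by ring
          simp_rw [e1]
          rw [e2]
          exact this
        · simp [Set.indicator_of_notMem he]
    _ = ∏ i, ∫⁻ x, ENNReal.ofReal (Real.exp ((μ * κ i) * x ^ 2 / 2)) ∂(gaussianReal 0 1) :=
        aux_lprod _ (fun i x => ENNReal.ofReal (Real.exp ((μ * κ i) * x ^ 2 / 2)))
          (fun i => by fun_prop)
    _ = _ := by
        have : ∀ i, μ * κ i < 1 := fun i => by nlinarith [h0 i, h1 i]
        simp_rw [fun i => aux_gauss (μ * κ i) (this i)]
        rw [← ENNReal.ofReal_prod_of_nonneg (fun i _ => (Real.exp_pos _).le), ← Real.exp_sum,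
          ← Finset.sum_div, Finset.sum_neg_distrib]
    _ ≤ _ := le_rfl

open ProbabilityTheory in
lemma aux_C {Ω : Type*} [MeasurableSpace Ω] (P : Measure Ω) [IsProbabilityMeasure P]
    {p : ℕ} (κ : Fin p → ℝ) (h0 : ∀ i, 0 ≤ κ i) (h1 : ∀ i, κ i ≤ 1)
    (hS : 1 ≤ ∑ i, κ i)
    (η : Ω → Fin p → ℝ) (hη : Measurable η) (g μ r0 r1 : ℝ) (hμ : 0 < μ) (hμ1 : μ < 1)
    (hr0 : 0 < r0) (hg : μ * r1 + √(μ * ∑ i, κ i) ≤ g)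
    (hm : ∀ b : Fin p → ℝ, ∑ i, b i ^ 2 ≤ g ^ 2 →
      ∫⁻ ω, ENNReal.ofReal (Real.exp (∑ i, b i * η ω i)) ∂P ≤
        ENNReal.ofReal (Real.exp ((∑ i, b i ^ 2) / 2))) :
    P {ω | r0 < √(∑ i, κ i * η ω i ^ 2) ∧ √(∑ i, κ i * η ω i ^ 2) ≤ r1} ≤
      ENNReal.ofReal ((2 + 1 / (2 * (μ * r0 ^ 2))) * Real.exp (-(μ * r0 ^ 2) / 2) *
        Real.exp (-(∑ i, Real.log (1 - μ * κ i)) / 2)) := by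
  set L := Real.exp (μ * r0 ^ 2 / 2) / (2 + 1 / (2 * (μ * r0 ^ 2))) with hL
  have hLpos : 0 < L := by positivity
  have hA := aux_A P κ h0 h1 η hη g μ hμ hμ1 hm
  set F : Ω → ENNReal := fun ω => ∫⁻ e, {e : Fin p → ℝ | μ * ∑ i, κ i * e i ^ 2 ≤ g ^ 2}.indicator
        (fun e => ENNReal.ofReal (Real.exp (∑ i, (√(μ * κ i) * η ω i) * e i))) e
        ∂(Measure.pi (fun _ : Fin p => gaussianReal 0 1)) with hF
  have hsub : {ω | r0 < √(∑ i, κ i * η ω i ^ 2) ∧ √(∑ i, κ i * η ω i ^ 2) ≤ r1} ⊆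
      {ω | ENNReal.ofReal L ≤ F ω} := by
    intro ω ⟨hω0, hω1⟩
    simp only [Set.mem_ofPred_eq]
    set r := √(∑ i, κ i * η ω i ^ 2) with hr
    have hrpos : 0 < r := hr0.trans hω0
    have hr2 : r ^ 2 = ∑ i, κ i * η ω i ^ 2 :=
      Real.sq_sqrt (Finset.sum_nonneg fun i _ => mul_nonneg (h0 i) (sq_nonneg _))
    have hB := aux_B κ h0 h1 hS μ g (√μ * r) hμ (by positivity) (fun i => √(μ * κ i) * η ω i)
      (by
        rw [mul_pow, Real.sq_sqrt hμ.le, hr2, Finset.mul_sum]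
        refine Finset.sum_congr rfl fun i _ => ?_
        rw [mul_pow, Real.sq_sqrt (mul_nonneg hμ.le (h0 i))]; ring)
      (by
        have : μ * (√μ * r + √(∑ i, κ i)) ^ 2 = (μ * r + √(μ * ∑ i, κ i)) ^ 2 := by
          rw [Real.sqrt_mul hμ.le]
          have := Real.sq_sqrt hμ.le
          calc μ * (√μ * r + √(∑ i, κ i)) ^ 2 = (√μ) ^ 2 * (√μ * r + √(∑ i, κ i)) ^ 2 := by rw [this]
            _ = ((√μ) ^ 2 * r + √μ * √(∑ i, κ i)) ^ 2 := by ring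
            _ = _ := by rw [this]
        rw [this]
        apply pow_le_pow_left₀ (by positivity)
        refine le_trans ?_ hg
        gcongr)
    refine le_trans (ENNReal.ofReal_le_ofReal ?_) hB
    rw [mul_pow, Real.sq_sqrt hμ.le, hL]
    gcongr
  have hmk := mul_meas_ge_le_lintegral₀ (μ := P) (f := F) ?_ (ENNReal.ofReal L)
  · have h2 : ENNReal.ofReal L * P {ω | r0 < √(∑ i, κ i * η ω i ^ 2) ∧ √(∑ i, κ i * η ω i ^ 2) ≤ r1} ≤
        ENNReal.ofReal (Real.exp (-(∑ i, Real.log (1 - μ * κ i)) / 2)) :=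
      (mul_le_mul_right (measure_mono hsub) _).trans (hmk.trans hA)
    have e : (2 + 1 / (2 * (μ * r0 ^ 2))) * Real.exp (-(μ * r0 ^ 2) / 2) = L⁻¹ := by
      rw [hL, inv_div, neg_div, Real.exp_neg]
      exact (div_eq_mul_inv _ _).symm
    rw [e, ENNReal.ofReal_mul (by positivity), ENNReal.ofReal_inv_of_pos hLpos]
    rw [← ENNReal.div_eq_inv_mul, ENNReal.le_div_iff_mul_le (by simp [hLpos]) (by simp), mul_comm]
    exact h2
  · apply Measurable.aemeasurable
    have hAm : MeasurableSet {e : Fin p → ℝ | μ * ∑ i, κ i * e i ^ 2 ≤ g ^ 2} :=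
      measurableSet_le (by fun_prop) (by fun_prop)
    have hmeas : Measurable (fun z : Ω × (Fin p → ℝ) =>
        {e : Fin p → ℝ | μ * ∑ i, κ i * e i ^ 2 ≤ g ^ 2}.indicator
        (fun e => ENNReal.ofReal (Real.exp (∑ i, (√(μ * κ i) * η z.1 i) * e i))) z.2) := by
      have : (fun z : Ω × (Fin p → ℝ) => {e : Fin p → ℝ | μ * ∑ i, κ i * e i ^ 2 ≤ g ^ 2}.indicator
        (fun e => ENNReal.ofReal (Real.exp (∑ i, (√(μ * κ i) * η z.1 i) * e i))) z.2) =
        (Prod.snd ⁻¹' {e : Fin p → ℝ | μ * ∑ i, κ i * e i ^ 2 ≤ g ^ 2}).indicator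
          (fun z : Ω × (Fin p → ℝ) =>
          ENNReal.ofReal (Real.exp (∑ i, (√(μ * κ i) * η z.1 i) * z.2 i))) := by
        funext z; rfl
      rw [this]
      exact Measurable.indicator (by fun_prop) (measurable_snd hAm)
    exact hmeas.lintegral_prod_right'

lemma aux_num (Y t : ℝ) (hY : 4 ≤ Y) (ht : t = 2 * Real.log 2) :
    (2 + 1 / (2 * (Y ^ 2 / (Y + t)))) * Real.exp (-(Y ^ 2 / (Y + t)) / 2) ≤
      4 * Real.exp (-Y / 2) := by
  have hl1 := Real.log_two_gt_d9
  have hl2 := Real.log_two_lt_d9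
  have ht1 : 1.386 < t := by rw [ht]; linarith
  have ht2 : t < 1.387 := by rw [ht]; linarith
  have hYt : 0 < Y + t := by linarith
  have e1 : Real.exp (-(Y ^ 2 / (Y + t)) / 2) =
      2 * Real.exp (-Y / 2) * Real.exp (-(t ^ 2 / (2 * (Y + t)))) := by
    have h2 : (2 : ℝ) = Real.exp (t / 2) := by
      rw [ht, mul_div_cancel_left₀ _ (by norm_num), Real.exp_log (by norm_num)]
    rw [show 2 * Real.exp (-Y / 2) = Real.exp (t / 2) * Real.exp (-Y / 2) by rw [← h2]]
    rw [← Real.exp_add, ← Real.exp_add]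
    congr 1
    field_simp
    ring
  have h3 : 1 + 1 / (4 * (Y ^ 2 / (Y + t))) ≤ Real.exp (t ^ 2 / (2 * (Y + t))) := by
    refine le_trans ?_ (Real.add_one_le_exp _)
    rw [add_comm]
    apply add_le_add_left
    have : 1 / (4 * (Y ^ 2 / (Y + t))) = (Y + t) / (4 * Y ^ 2) := by field_simp
    rw [this, div_le_div_iff₀ (by positivity) (by positivity)]
    have a1 : Y + t ≤ 1.35 * Y := by linarith
    have a2 : (Y + t) * (Y + t) ≤ (1.35 * Y) * (1.35 * Y) :=
      mul_self_le_mul_self hYt.le a1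
    have a3 : 1.386 * 1.386 ≤ t * t := mul_self_le_mul_self (by norm_num) ht1.le
    nlinarith [sq_nonneg Y]
  rw [e1]
  have h4 : (1 + 1 / (4 * (Y ^ 2 / (Y + t)))) * Real.exp (-(t ^ 2 / (2 * (Y + t)))) ≤ 1 := by
    rw [Real.exp_neg, ← div_eq_mul_inv, div_le_one (Real.exp_pos _)]
    exact h3
  have e5 : (2 + 1 / (2 * (Y ^ 2 / (Y + t)))) = 2 * (1 + 1 / (4 * (Y ^ 2 / (Y + t)))) := by
    field_simp; ring
  rw [e5]
  nlinarith [Real.exp_pos (-Y / 2)]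

set_option maxHeartbeats 1000000 in
lemma aux_D {Ω : Type*} [MeasurableSpace Ω] (P : Measure Ω) [IsProbabilityMeasure P]
    {p : ℕ} (κ : Fin p → ℝ) (h0 : ∀ i, 0 ≤ κ i) (h1 : ∀ i, κ i ≤ 1)
    (hS : 1 ≤ ∑ i, κ i)
    (η : Ω → Fin p → ℝ) (hη : Measurable η) (g μc yc γc y : ℝ) (hμ : 0 < μc) (hμ1 : μc < 1)
    (hyc : 0 < yc) (hγ1 : μc * yc ≤ γc) (hγ2 : γc ≤ 2 * (μc * yc))
    (hg : γc + √(μc * ∑ i, κ i) ≤ g) (hy : yc ≤ y)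
    (hm : ∀ b : Fin p → ℝ, ∑ i, b i ^ 2 ≤ g ^ 2 →
      ∫⁻ ω, ENNReal.ofReal (Real.exp (∑ i, b i * η ω i)) ∂P ≤
        ENNReal.ofReal (Real.exp ((∑ i, b i ^ 2) / 2))) :
    P {ω | y < √(∑ i, κ i * η ω i ^ 2)} ≤
      ENNReal.ofReal (8.4 * Real.exp (-((μc * yc ^ 2 + ∑ i, Real.log (1 - μc * κ i)) / 2) -
        γc * (y - yc) / 2)) := by
  have hlog : ∑ i, Real.log (1 - μc * κ i) ≤ 0 := by
    refine Finset.sum_nonpos fun i _ => Real.log_nonpos ?_ ?_ <;> nlinarith [h0 i, h1 i]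
  have hγ0 : 0 < γc := lt_of_lt_of_le (by positivity) hγ1
  have hy0 : 0 < y := lt_of_lt_of_le hyc hy
  have hyy : μc * yc ^ 2 ≤ γc * yc := by nlinarith
  rcases le_or_gt (γc * y) 4 with hY | hY
  · refine prob_le_one.trans ?_
    rw [← ENNReal.ofReal_one]
    apply ENNReal.ofReal_le_ofReal
    have : Real.exp (-2) ≤ Real.exp (-((μc * yc ^ 2 + ∑ i, Real.log (1 - μc * κ i)) / 2) -
        γc * (y - yc) / 2) := by
      apply Real.exp_le_exp.2
      nlinarith
    have h2 : Real.exp 2 ≤ 8.4 := by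
      have := Real.exp_one_lt_d9
      rw [show (2 : ℝ) = 1 + 1 by norm_num, Real.exp_add]
      nlinarith [Real.exp_pos 1]
    have h3 : Real.exp 2 * Real.exp (-2) = 1 := by rw [← Real.exp_add]; simp
    nlinarith [Real.exp_pos (-2)]
  set t := 2 * Real.log 2 with ht
  have ht0 : 0 < t := by 
    have : 0 < Real.log 2 := Real.log_pos (by norm_num)
    positivity
  set δ := t / γc with hδ
  have hδ0 : 0 < δ := by positivity
  set D := Real.exp (-(∑ i, Real.log (1 - μc * κ i)) / 2) with hD
  set T := Real.exp (-(μc * yc ^ 2) / 2 - γc * (y - yc) / 2) with hT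
  have hTD : Real.exp (-((μc * yc ^ 2 + ∑ i, Real.log (1 - μc * κ i)) / 2) -
        γc * (y - yc) / 2) = T * D := by
    rw [hT, hD, ← Real.exp_add]; congr 1; ring
  set Q : Ω → ℝ := fun ω => √(∑ i, κ i * η ω i ^ 2) with hQ
  have hcover : {ω | y < Q ω} ⊆ ⋃ k : ℕ, {ω | y + k * δ < Q ω ∧ Q ω ≤ y + k * δ + δ} := by
    intro ω hω
    simp only [Set.mem_ofPred_eq] at hω
    simp only [Set.mem_iUnion, Set.mem_ofPred_eq]
    have hz : 0 < (Q ω - y) / δ := div_pos (by linarith) hδ0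
    have hc0 : 0 < ⌈(Q ω - y) / δ⌉₊ := Nat.ceil_pos.2 hz
    obtain ⟨k, hk⟩ : ∃ k, ⌈(Q ω - y) / δ⌉₊ = k + 1 := ⟨_, (Nat.succ_pred_eq_of_pos hc0).symm⟩
    refine ⟨k, ?_, ?_⟩
    · have : (k : ℝ) < (Q ω - y) / δ := Nat.lt_ceil.1 (by omega)
      rw [lt_div_iff₀ hδ0] at this
      linarith
    · have := Nat.le_ceil ((Q ω - y) / δ)
      rw [hk, div_le_iff₀ hδ0] at this
      push_cast at this
      linarith
  have hlev : ∀ k : ℕ, P {ω | y + k * δ < Q ω ∧ Q ω ≤ y + k * δ + δ} ≤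
      ENNReal.ofReal (4 * T * D * (1 / 2) ^ k) := by
    intro k
    set yk := y + k * δ with hyk
    have hkk : (0 : ℝ) ≤ k * δ := by positivity
    have hyk0 : 0 < yk := by linarith
    have hykc : yc ≤ yk := by linarith
    have hyk1 : 0 < yk + δ := by linarith
    have hYk : γc * yk = γc * y + k * t := by
      rw [hyk, hδ]; field_simp
    have hYk4 : 4 ≤ γc * yk := by rw [hYk]; nlinarith [mul_nonneg (Nat.cast_nonneg (α := ℝ) k) ht0.le]
    have hpow : ((1 : ℝ) / 2) ^ k = Real.exp (-(k * t) / 2) := by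
      rw [ht, show -((k : ℝ) * (2 * Real.log 2)) / 2 = (k : ℝ) * (-Real.log 2) by ring,
        Real.exp_nat_mul, Real.exp_neg, Real.exp_log (by norm_num), one_div]
    have hTk : T * (1 / 2) ^ k = Real.exp (-(μc * yc ^ 2) / 2 - γc * (yk - yc) / 2) := by
      rw [hpow, hT, ← Real.exp_add]; congr 1
      have : γc * (yk - yc) = γc * (y - yc) + k * t := by rw [mul_sub, hYk]; ring
      rw [this]; ring
    rw [show 4 * T * D * (1 / 2) ^ k = (4 * (T * (1 / 2) ^ k)) * D by ring, hTk]
    have hD0 : 0 < D := Real.exp_pos _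
    rcases le_or_gt (μc * (yk + δ)) γc with hc | hc
    · have hC := aux_C P κ h0 h1 hS η hη g μc yk (yk + δ) hμ hμ1 hyk0 (by linarith) hm
      refine hC.trans (ENNReal.ofReal_le_ofReal ?_)
      rw [← hD]
      apply mul_le_mul_of_nonneg_right _ hD0.le
      have ha : 1 ≤ μc * yk ^ 2 := by
        have : μc * yc * yk ≤ μc * yk ^ 2 := by
          rw [mul_assoc, sq]; gcongr
        nlinarith
      apply mul_le_mul _ _ (Real.exp_pos _).le (by norm_num)
      · have : 1 / (2 * (μc * yk ^ 2)) ≤ 1 := by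
          rw [div_le_one (by positivity)]; linarith
        linarith
      · apply Real.exp_le_exp.2
        have : γc * (yk - yc) ≤ μc * (yk + yc) * (yk - yc) := by
          apply mul_le_mul_of_nonneg_right _ (by linarith)
          nlinarith
        nlinarith
    · set μ := γc / (yk + δ) with hμd
      have hμp : 0 < μ := by positivity
      have hμμ : μ ≤ μc := by rw [hμd, div_le_iff₀ hyk1]; exact hc.le
      have hμr : μ * (yk + δ) = γc := by rw [hμd]; field_simp
      have hC := aux_C P κ h0 h1 hS η hη g μ yk (yk + δ) hμp (by linarith) hyk0 (by
        rw [hμr]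
        refine le_trans ?_ hg
        gcongr) hm
      refine hC.trans (ENNReal.ofReal_le_ofReal ?_)
      apply mul_le_mul _ _ (Real.exp_pos _).le (by positivity)
      · have hn := aux_num (γc * yk) t hYk4 ht
        have e : (γc * yk) ^ 2 / (γc * yk + t) = μ * yk ^ 2 := by
          have : γc * yk + t = γc * (yk + δ) := by rw [hδ]; field_simp
          rw [this, hμd]; field_simp
        rw [e] at hn
        refine hn.trans ?_
        apply mul_le_mul_of_nonneg_left _ (by norm_num)
        apply Real.exp_le_exp.2
        have e3 : γc * (yk - yc) = γc * yk - γc * yc := by ring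
        linarith
      · apply Real.exp_le_exp.2
        have : ∑ i, Real.log (1 - μc * κ i) ≤ ∑ i, Real.log (1 - μ * κ i) := by
          refine Finset.sum_le_sum fun i _ => Real.log_le_log ?_ ?_ <;> nlinarith [h0 i, h1 i]
        linarith
  rw [hTD]
  have hTD0 : 0 < T * D := mul_pos (Real.exp_pos _) (Real.exp_pos _)
  have hsum : HasSum (fun k : ℕ => 4 * T * D * (1 / 2 : ℝ) ^ k) (4 * T * D * 2) :=
    hasSum_geometric_two.mul_left _
  calc P {ω | y < Q ω} ≤ ∑' k : ℕ, P {ω | y + k * δ < Q ω ∧ Q ω ≤ y + k * δ + δ} :=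
        (measure_mono hcover).trans (measure_iUnion_le _)
    _ ≤ ∑' k : ℕ, ENNReal.ofReal (4 * T * D * (1 / 2) ^ k) := ENNReal.tsum_le_tsum hlev
    _ = ENNReal.ofReal (4 * T * D * 2) := by
        rw [← ENNReal.ofReal_tsum_of_nonneg (fun k => by positivity) hsum.summable, hsum.tsum_eq]
    _ ≤ _ := by
        apply ENNReal.ofReal_le_ofReal
        nlinarith

lemma aux_spec {p : ℕ} (B : Matrix (Fin p) (Fin p) ℝ) (hB : B.IsHermitian)
    (v : EuclideanSpace ℝ (Fin p)) :
    ‖mApp B v‖ ^ 2 = ∑ i, (hB.pow 2).eigenvalues i *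
      ⟪(hB.pow 2).eigenvectorBasis i, v⟫ ^ 2 := by
  have hsym : (Matrix.toEuclideanLin B).IsSymmetric := Matrix.isSymmetric_toEuclideanLin_iff.2 hB
  have hsym2 : (Matrix.toEuclideanLin (B ^ 2)).IsSymmetric :=
    Matrix.isSymmetric_toEuclideanLin_iff.2 (hB.pow 2)
  have hBB : Matrix.toEuclideanLin B (Matrix.toEuclideanLin B v) =
      Matrix.toEuclideanLin (B ^ 2) v := by
    apply (WithLp.ofLp_injective 2)
    simp [sq, Matrix.mulVec_mulVec]
  have h1 : ‖mApp B v‖ ^ 2 = ⟪v, Matrix.toEuclideanLin (B ^ 2) v⟫ := by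
    rw [← hBB, ← hsym, mApp, ← real_inner_self_eq_norm_sq]
  rw [h1, ← (hB.pow 2).eigenvectorBasis.sum_inner_mul_inner]
  refine Finset.sum_congr rfl fun i _ => ?_
  have h2 : Matrix.toEuclideanLin (B ^ 2) ((hB.pow 2).eigenvectorBasis i) =
      (hB.pow 2).eigenvalues i • (hB.pow 2).eigenvectorBasis i := by
    apply (WithLp.ofLp_injective 2)
    exact (hB.pow 2).mulVec_eigenvectorBasis i
  rw [← hsym2, h2, real_inner_smul_left, real_inner_comm]
  ring

lemma aux_eig_nonneg {p : ℕ} (B : Matrix (Fin p) (Fin p) ℝ) (hB : B.IsHermitian) (i : Fin p) :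
    0 ≤ (hB.pow 2).eigenvalues i := by
  have h := aux_spec B hB ((hB.pow 2).eigenvectorBasis i)
  have h2 : ∀ j, ⟪(hB.pow 2).eigenvectorBasis j, (hB.pow 2).eigenvectorBasis i⟫ =
      if j = i then (1 : ℝ) else 0 :=
    fun j => orthonormal_iff_ite.1 (hB.pow 2).eigenvectorBasis.orthonormal j i
  simp_rw [h2] at h
  simp at h
  rw [← h]; positivity

lemma aux_det {p : ℕ} (A : Matrix (Fin p) (Fin p) ℝ) (hA : A.IsHermitian) (m : ℝ) (hm : m ≠ 0) :
    Matrix.det (1 - m • A) = ∏ i, (1 - m * hA.eigenvalues i) := by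
  have h := congrArg (Polynomial.eval m⁻¹) hA.charpoly_eq
  rw [Matrix.eval_charpoly, Polynomial.eval_prod] at h
  have e : (1 - m • A) = m • (Matrix.scalar (Fin p) m⁻¹ - A) := by
    rw [smul_sub]
    congr 1
    ext i j
    by_cases hij : i = j
    · subst hij; simp [hm]
    · simp [hij]
  rw [e, Matrix.det_smul, h, Fintype.card_fin, ← Fin.prod_const, ← Finset.prod_mul_distrib]
  refine Finset.prod_congr rfl fun i _ => ?_
  simp [mul_sub, hm]

set_option maxHeartbeats 1000000 in
/-- Theorem `TxivqLDA`, second part: under the sub-Gaussian moment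
condition on `ξ` and with `B` symmetric, `λ_max(B²) = 1`, for every `y ≥ y_c`:
`P(‖Bξ‖ > y) ≤ 8.4 exp(-x_c - γ_c (y - y_c)/2)` where `γ_c = g - √(μ_c 𝚙)`. -/
theorem stmt7 {Ω : Type*} [MeasurableSpace Ω] (P : Measure Ω) [IsProbabilityMeasure P]
    {p : ℕ} (hp : 0 < p)
    (ξ : Ω → EuclideanSpace ℝ (Fin p)) (g : ℝ) (hg : 0 < g)
    (hmom : ∀ γ : EuclideanSpace ℝ (Fin p), ‖γ‖ ≤ g →
      Integrable (fun ω => Real.exp ⟪γ, ξ ω⟫) P ∧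
        Real.log (∫ ω, Real.exp ⟪γ, ξ ω⟫ ∂P) ≤ ‖γ‖ ^ 2 / 2)
    (B : Matrix (Fin p) (Fin p) ℝ) (hB : B.IsHermitian)
    (hBmax : (⨆ i, (hB.pow 2).eigenvalues i) = 1)
    (pB vB wc μc yc xc γc : ℝ)
    (hpB : pB = Matrix.trace (B ^ 2))
    (hvB : vB = Real.sqrt (2 * Matrix.trace (B ^ 4)))
    (hwc_pos : 0 < wc)
    (hwc : wc * (1 + wc) / Real.sqrt (1 + wc ^ 2) = g / Real.sqrt pB)
    (hμc : μc = min (wc ^ 2 / (1 + wc ^ 2)) (2 / 3))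
    (hyc : yc = Real.sqrt ((1 + wc ^ 2) * pB))
    (hxc : xc = (μc * yc ^ 2 + Real.log (Matrix.det (1 - μc • B ^ 2))) / 2)
    (hγc : γc = g - Real.sqrt (μc * pB))
    (y : ℝ) (hy : yc ≤ y) :
    P {ω | ‖mApp B (ξ ω)‖ > y} ≤
      ENNReal.ofReal (8.4 * Real.exp (-xc - γc * (y - yc) / 2)) := by
  have : Nonempty (Fin p) := ⟨⟨0, hp⟩⟩
  set κ := (hB.pow 2).eigenvalues with hκ
  set U := (hB.pow 2).eigenvectorBasis with hU
  have h0 : ∀ i, 0 ≤ κ i := aux_eig_nonneg B hB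
  have h1 : ∀ i, κ i ≤ 1 := fun i => by
    rw [← hBmax]; exact le_ciSup (Set.finite_range κ).bddAbove i
  have hSeq : pB = ∑ i, κ i := by
    rw [hpB, (hB.pow 2).trace_eq_sum_eigenvalues]; simp [hκ]
  have hS : 1 ≤ ∑ i, κ i := by
    obtain ⟨i, hi⟩ := exists_eq_ciSup_of_finite (f := κ)
    rw [← hBmax, ← hi]
    exact Finset.single_le_sum (fun j _ => h0 j) (Finset.mem_univ i)
  have hpB1 : 1 ≤ pB := hSeq ▸ hS
  have hpB0 : 0 < pB := by linarith
  -- numbers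
  have hw1 : 0 < 1 + wc ^ 2 := by positivity
  have hμ0 : 0 < μc := by rw [hμc]; exact lt_min (by positivity) (by norm_num)
  have hμ1 : μc < 1 := by
    rw [hμc]; exact lt_of_le_of_lt (min_le_right _ _) (by norm_num)
  have hμw : μc * (1 + wc ^ 2) ≤ wc ^ 2 := by
    rw [← le_div_iff₀ hw1, hμc]; exact min_le_left _ _
  set s := √(1 + wc ^ 2) with hs
  set q := √pB with hq
  have hs0 : 0 < s := Real.sqrt_pos.2 hw1
  have hq0 : 0 < q := Real.sqrt_pos.2 hpB0
  have hs2 : s ^ 2 = 1 + wc ^ 2 := Real.sq_sqrt hw1.le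
  have hycq : yc = s * q := by rw [hyc, Real.sqrt_mul hw1.le]
  have hyc0 : 0 < yc := by rw [hycq]; positivity
  have hgq : g * s = wc * (1 + wc) * q := by
    field_simp at hwc; linarith
  set m := √μc with hm
  have hm0 : 0 < m := Real.sqrt_pos.2 hμ0
  have hm2 : m ^ 2 = μc := Real.sq_sqrt hμ0.le
  have hγq : γc = g - m * q := by rw [hγc, Real.sqrt_mul hμ0.le]
  have hms : m * s ≤ wc := by
    apply le_of_sq_le_sq _ hwc_pos.le
    rw [mul_pow, hm2, hs2]; exact hμw
  have hγ1 : μc * yc ≤ γc := by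
    have : μc * yc * s ≤ γc * s := by
      have e1 : γc * s = (wc * (1 + wc) - m * s) * q := by rw [hγq, sub_mul, hgq]; ring
      have e2 : μc * yc * s = (μc * (1 + wc ^ 2)) * q := by rw [hycq, ← hs2]; ring
      rw [e1, e2]
      apply mul_le_mul_of_nonneg_right _ hq0.le
      nlinarith
    exact le_of_mul_le_mul_right this hs0
  have hγ2 : γc ≤ 2 * (μc * yc) := by
    have : γc * s ≤ 2 * (μc * yc) * s := by
      have e1 : γc * s = (wc * (1 + wc) - m * s) * q := by rw [hγq, sub_mul, hgq]; ring
      have e2 : 2 * (μc * yc) * s = 2 * (μc * (1 + wc ^ 2)) * q := by rw [hycq, ← hs2]; ring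
      rw [e1, e2]
      apply mul_le_mul_of_nonneg_right _ hq0.le
      rcases min_choice (wc ^ 2 / (1 + wc ^ 2)) (2 / 3) with hc | hc
      · rw [hc] at hμc
        have e3 : μc * (1 + wc ^ 2) = wc ^ 2 := by rw [hμc]; field_simp
        have e4 : m * s = wc := by
          have : (m * s) ^ 2 = wc ^ 2 := by rw [mul_pow, hm2, hs2, e3]
          exact (pow_left_inj₀ (by positivity) hwc_pos.le (by norm_num)).1 this
        rw [e3, e4]; nlinarith
      · rw [hc] at hμc
        rw [hμc]
        have : 0 < m * s := by positivity
        nlinarith [sq_nonneg (wc - 3 / 2)]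
    exact le_of_mul_le_mul_right this hs0
  -- measurability
  have hco : ∀ i, AEMeasurable (fun ω => ⟪U i, ξ ω⟫) P := by
    intro i
    have hi := (hmom (g • U i) (by
      rw [norm_smul, U.orthonormal.1 i, mul_one, Real.norm_of_nonneg hg.le])).1
    have h2 := (Real.measurable_log.comp_aemeasurable hi.aestronglyMeasurable.aemeasurable).const_mul g⁻¹
    refine h2.congr (Filter.Eventually.of_forall fun ω => ?_)
    simp only [Function.comp, Real.log_exp, real_inner_smul_left]
    field_simp
  have hη' : AEMeasurable (fun ω i => ⟪U i, ξ ω⟫) P := aemeasurable_pi_lambda _ hco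
  set η : Ω → Fin p → ℝ := hη'.mk _ with hηd
  have hη : Measurable η := hη'.measurable_mk
  have hae : (fun ω i => ⟪U i, ξ ω⟫) =ᵐ[P] η := hη'.ae_eq_mk
  have hmm : ∀ b : Fin p → ℝ, ∑ i, b i ^ 2 ≤ g ^ 2 →
      ∫⁻ ω, ENNReal.ofReal (Real.exp (∑ i, b i * η ω i)) ∂P ≤
        ENNReal.ofReal (Real.exp ((∑ i, b i ^ 2) / 2)) := by
    intro b hb
    set γ : EuclideanSpace ℝ (Fin p) := ∑ i, b i • U i with hγ
    have hn : ‖γ‖ ^ 2 = ∑ i, b i ^ 2 := by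
      rw [← real_inner_self_eq_norm_sq, hγ, U.orthonormal.inner_sum]
      simp [sq]
    have hin : ∀ ω, ⟪γ, ξ ω⟫ = ∑ i, b i * ⟪U i, ξ ω⟫ := by
      intro ω
      rw [hγ, sum_inner]
      simp_rw [real_inner_smul_left]
    obtain ⟨hi, hl⟩ := hmom γ (by
      apply le_of_sq_le_sq _ hg.le
      rw [hn]; exact hb)
    have hpos : 0 < ∫ ω, Real.exp ⟪γ, ξ ω⟫ ∂P := integral_exp_pos hi
    rw [Real.log_le_iff_le_exp hpos, hn] at hl
    have e : ∫⁻ ω, ENNReal.ofReal (Real.exp (∑ i, b i * η ω i)) ∂P =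
        ENNReal.ofReal (∫ ω, Real.exp ⟪γ, ξ ω⟫ ∂P) := by
      rw [ofReal_integral_eq_lintegral_ofReal hi
        (Filter.Eventually.of_forall fun ω => (Real.exp_pos _).le)]
      refine lintegral_congr_ae ?_
      filter_upwards [hae] with ω hω
      rw [hin, ← hω]
    rw [e]
    exact ENNReal.ofReal_le_ofReal hl
  have hfin := aux_D P κ h0 h1 hS η hη g μc yc γc y hμ0 hμ1 hyc0 hγ1 hγ2
    (by rw [← hSeq, hγc]; linarith) hy hmm
  have hset : P {ω | ‖mApp B (ξ ω)‖ > y} = P {ω | y < √(∑ i, κ i * η ω i ^ 2)} := by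
    apply measure_congr
    filter_upwards [hae] with ω hω
    have e : ‖mApp B (ξ ω)‖ = √(∑ i, κ i * η ω i ^ 2) := by
      rw [← hω, ← aux_spec B hB (ξ ω), Real.sqrt_sq (norm_nonneg _)]
    apply propext
    change ‖mApp B (ξ ω)‖ > y ↔ y < √(∑ i, κ i * η ω i ^ 2)
    rw [e]
  have hdet : Real.log (Matrix.det (1 - μc • B ^ 2)) = ∑ i, Real.log (1 - μc * κ i) := by
    rw [aux_det _ (hB.pow 2) μc hμ0.ne', Real.log_prod]
    intro i _
    have : μc * κ i < 1 := lt_of_le_of_lt (mul_le_of_le_one_right hμ0.le (h1 i)) hμ1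
    exact (sub_pos.2 this).ne'
  rw [hset, hxc, hdet]
  exact hfin
end

section
/- Let ξ be a random vector in ℝᵖ with log 𝔼 exp(γᵀξ) ≤ ‖γ‖²/2 for all γ with ‖γ‖ ≤ g, where g² ≥ 2𝚙, and let B be symmetric with λ_max(B²) = 1. Then for x > x_c: P( ‖Bξ‖² ≥ 𝔷_c(x,B) ) ≤ 8.4 e^{−x}, where 𝔷_c(x,B) = ( y_c + 2(x − x_c)/γ_c )² and γ_c = g·w_c/(1+w_c). -/
open MeasureTheory Real
open scoped RealInnerProductSpace

open ProbabilityTheory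
open scoped ENNReal

noncomputable abbrev gpi (p : ℕ) : Measure (Fin p → ℝ) := Measure.pi fun _ => gaussianReal 0 1

lemma gpi_lintegral_prod {p : ℕ} (f : Fin p → ℝ → ℝ≥0∞) (hf : ∀ i, Measurable (f i)) :
    ∫⁻ x, ∏ i, f i (x i) ∂(gpi p) = ∏ i, ∫⁻ t, f i t ∂(gaussianReal 0 1) := by
  have hi : iIndepFun (fun i (x : Fin p → ℝ) => f i (x i)) (gpi p) :=
    iIndepFun_pi (fun i => (hf i).aemeasurable)
  rw [lintegral_prod_eq_prod_lintegral_of_indepFun _ _ hi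
    (fun i => (hf i).comp (measurable_pi_apply i))]
  refine Finset.prod_congr rfl fun i _ => ?_
  exact (measurePreserving_eval (fun _ : Fin p => gaussianReal 0 1) i).lintegral_comp (hf i)

lemma gauss_lintegral {f : ℝ → ℝ≥0∞} (hf : Measurable f) :
    ∫⁻ t, f t ∂(gaussianReal 0 1) = ∫⁻ t, ENNReal.ofReal ((√(2 * π))⁻¹ * exp (-t ^ 2 / 2)) * f t := by
  rw [gaussianReal_of_var_ne_zero 0 one_ne_zero,
    lintegral_withDensity_eq_lintegral_mul _ (measurable_gaussianPDF 0 1) hf]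
  refine lintegral_congr fun t => ?_
  simp [gaussianPDF, gaussianPDFReal]

lemma gauss_shift {f : ℝ → ℝ≥0∞} (hf : Measurable f) (a : ℝ) :
    ∫⁻ t, f (t + a) * ENNReal.ofReal (exp (-(a * t) - a ^ 2 / 2)) ∂(gaussianReal 0 1)
      = ∫⁻ t, f t ∂(gaussianReal 0 1) := by
  rw [gauss_lintegral hf, gauss_lintegral (by fun_prop)]
  conv_rhs => rw [← lintegral_add_right_eq_self _ a]
  refine lintegral_congr fun t => ?_
  rw [mul_comm (f _), ← mul_assoc, ← ENNReal.ofReal_mul (by positivity), mul_assoc, ← exp_add]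
  congr 4
  ring

lemma gpi_shift_measure {p : ℕ} (a : Fin p → ℝ) :
    ((gpi p).withDensity (fun x => ∏ i, ENNReal.ofReal (exp (-(a i * x i) - a i ^ 2 / 2)))).map
      (fun x => x + a) = gpi p := by
  refine (Measure.pi_eq fun s hs => ?_).symm
  have hS : MeasurableSet (Set.univ.pi s) := MeasurableSet.univ_pi hs
  have hm : Measurable (fun x : Fin p → ℝ => x + a) := by fun_prop
  rw [Measure.map_apply hm hS, withDensity_apply _ (hm hS), ← lintegral_indicator (hm hS)]
  have : ∀ x : Fin p → ℝ, ((fun x => x + a) ⁻¹' Set.univ.pi s).indicator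
      (fun x => ∏ i, ENNReal.ofReal (exp (-(a i * x i) - a i ^ 2 / 2))) x
      = ∏ i, (((s i).indicator (fun _ => (1 : ℝ≥0∞)) (x i + a i)) *
        ENNReal.ofReal (exp (-(a i * x i) - a i ^ 2 / 2))) := by
    intro x
    by_cases hx : x ∈ (fun x => x + a) ⁻¹' Set.univ.pi s
    · rw [Set.indicator_of_mem hx]
      refine Finset.prod_congr rfl fun i _ => ?_
      have : x i + a i ∈ s i := hx i (Set.mem_univ i)
      simp [this]
    · rw [Set.indicator_of_notMem hx]
      have : ∃ i, x i + a i ∉ s i := by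
        by_contra! h
        exact hx (fun i _ => h i)
      obtain ⟨i, hi⟩ := this
      exact (Finset.prod_eq_zero (Finset.mem_univ i) (by simp [hi])).symm
  simp_rw [this]
  have hmi : ∀ i, Measurable ((s i).indicator (fun _ => (1 : ℝ≥0∞))) :=
    fun i => measurable_const.indicator (hs i)
  rw [gpi_lintegral_prod (fun i t => (s i).indicator (fun _ => (1 : ℝ≥0∞)) (t + a i) *
    ENNReal.ofReal (exp (-(a i * t) - a i ^ 2 / 2)))
    (fun i => ((hmi i).comp (by fun_prop)).mul (by fun_prop))]
  refine Finset.prod_congr rfl fun i _ => ?_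
  rw [gauss_shift (hmi i), lintegral_indicator (hs i)]
  simp

lemma gpi_shift {p : ℕ} (a : Fin p → ℝ) {f : (Fin p → ℝ) → ℝ≥0∞} (hf : Measurable f) :
    ∫⁻ x, f x ∂(gpi p) = ∫⁻ x, ENNReal.ofReal (exp (-(∑ i, a i * x i) - (∑ i, a i ^ 2) / 2)) *
      f (x + a) ∂(gpi p) := by
  conv_lhs => rw [← gpi_shift_measure a]
  rw [lintegral_map hf (by fun_prop), lintegral_withDensity_eq_lintegral_mul _ (by fun_prop)
    (by fun_prop)]
  refine lintegral_congr fun x => ?_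
  simp only [Pi.mul_apply]
  rw [← ENNReal.ofReal_prod_of_nonneg (fun i _ => (exp_pos _).le), ← exp_sum]
  congr 3
  rw [Finset.sum_sub_distrib, Finset.sum_neg_distrib, Finset.sum_div]

lemma gpi_neg {p : ℕ} {f : (Fin p → ℝ) → ℝ≥0∞} (hf : Measurable f) :
    ∫⁻ x, f (-x) ∂(gpi p) = ∫⁻ x, f x ∂(gpi p) := by
  have h : (gpi p).map (fun x i => - (x i)) = gpi p := by
    have hs : ∀ i : Fin p, SigmaFinite ((gaussianReal 0 1).map (fun x : ℝ => -x)) := fun i => by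
      rw [gaussianReal_map_neg]; infer_instance
    rw [gpi, Measure.pi_map_pi (f := fun _ x => -x) (fun i => by fun_prop)]
    congr 1
    funext i
    rw [gaussianReal_map_neg]; simp
  conv_rhs => rw [← h]
  rw [lintegral_map hf (by fun_prop)]
  rfl

lemma gauss_sq_exp {c : ℝ} (hc : c < 1) :
    ∫⁻ t, ENNReal.ofReal (exp (c * t ^ 2 / 2)) ∂(gaussianReal 0 1)
      = ENNReal.ofReal (√(1 - c))⁻¹ := by
  rw [gauss_lintegral (by fun_prop)]
  have h1 : ∀ t : ℝ, ENNReal.ofReal ((√(2 * π))⁻¹ * exp (-t ^ 2 / 2)) *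
      ENNReal.ofReal (exp (c * t ^ 2 / 2)) =
      ENNReal.ofReal ((√(2 * π))⁻¹ * exp (-((1 - c) / 2) * t ^ 2)) := by
    intro t
    rw [← ENNReal.ofReal_mul (by positivity), mul_assoc, ← exp_add]
    congr 3; ring
  simp_rw [h1]
  rw [← ofReal_integral_eq_lintegral_ofReal
    ((integrable_exp_neg_mul_sq (by linarith)).const_mul _) (ae_of_all _ fun t => by positivity),
    integral_const_mul, integral_gaussian]
  congr 1
  have : π / ((1 - c) / 2) = (2 * π) / (1 - c) := by
    have : (1 - c) ≠ 0 := by linarith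
    field_simp
  have h2 : 0 < √(2 * π) := by positivity
  rw [this, sqrt_div (by positivity)]
  field_simp

lemma gauss_abs : ∫ t, |t| ∂(gaussianReal 0 1) ≤ 0.8 := by
  rw [integral_gaussianReal_eq_integral_smul one_ne_zero]
  have h : ∀ t : ℝ, gaussianPDFReal 0 1 t • |t| = (√(2 * π))⁻¹ * (|t| * exp (-(1/2) * |t| ^ 2)) := by
    intro t
    simp [gaussianPDFReal]; ring_nf
  simp_rw [h]
  rw [integral_const_mul, integral_comp_abs (f := fun t => t * exp (-(1/2) * t ^ 2))]
  have h2 : ∫ t in Set.Ioi (0:ℝ), t * exp (-(1/2) * t ^ 2) = 1 := by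
    have := integral_rpow_mul_exp_neg_mul_rpow (p := 2) (q := 1) (b := 1/2) (by norm_num) (by norm_num) (by norm_num)
    norm_num at this
    simpa using this
  rw [h2]
  have h3 : (2.5 : ℝ) ≤ √(2 * π) := by
    apply le_sqrt_of_sq_le
    have := pi_gt_d2
    norm_num; linarith
  rw [mul_one]
  calc (√(2 * π))⁻¹ * 2 ≤ (2.5)⁻¹ * 2 := by gcongr
    _ ≤ 0.8 := by norm_num

lemma gpi_lin_integrable {p : ℕ} (i : Fin p) : Integrable (fun x : Fin p → ℝ => x i) (gpi p) := by
  have := (memLp_id_gaussianReal (μ := 0) (v := 1) 1).integrable (by simp)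
  exact (measurePreserving_eval (fun _ : Fin p => gaussianReal 0 1) i).integrable_comp_of_integrable this

lemma gpi_abs {p : ℕ} (c : Fin p → ℝ) (hc : ∑ i, c i ^ 2 ≤ 1) :
    ∫ x, |∑ i, c i * x i| ∂(gpi p) ≤ 0.8 := by
  have hid : ∀ i, MemLp (fun t => c i * t) 2 (gaussianReal 0 1) := fun i =>
    (memLp_id_gaussianReal (μ := 0) (v := 1) 2).const_mul _
  have hI : iIndepFun (fun i (x : Fin p → ℝ) => c i * x i) (gpi p) :=
    iIndepFun_pi (X := fun i t => c i * t) (fun i => by fun_prop)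
  have hG : HasGaussianLaw (fun x : Fin p → ℝ => ∑ i, c i * x i) (gpi p) := by
    refine iIndepFun.hasGaussianLaw_fun_sum (fun i => ⟨?_⟩) hI
    have : (gpi p).map (fun x => c i * x i) = (gaussianReal 0 1).map (fun t => c i * t) := by
      rw [← (measurePreserving_eval (fun _ : Fin p => gaussianReal 0 1) i).map_eq,
        Measure.map_map (by fun_prop) (by fun_prop)]
      rfl
    rw [this, gaussianReal_map_const_mul]
    infer_instance
  have hmap := hG.map_eq_gaussianReal
  have hmean : ∫ x, ∑ i, c i * x i ∂(gpi p) = 0 := by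
    rw [integral_finsetSum _ (fun i _ => (gpi_lin_integrable i).const_mul _)]
    refine Finset.sum_eq_zero fun i _ => ?_
    rw [integral_const_mul, integral_comp_eval (μ := fun _ : Fin p => gaussianReal 0 1) (i := i) (f := fun t : ℝ => t) (by fun_prop)]
    simp
  have hvar : Var[fun x : Fin p → ℝ => ∑ i, c i * x i; gpi p] = ∑ i, c i ^ 2 := by
    have := variance_sum_pi (μ := fun _ : Fin p => gaussianReal 0 1) (X := fun i t => c i * t) hid
    have e : (fun x : Fin p → ℝ => ∑ i, c i * x i) = ∑ i, fun x : Fin p → ℝ => c i * x i := by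
      ext x; simp
    rw [e, this]
    refine Finset.sum_congr rfl fun i _ => ?_
    rw [variance_const_mul]; simp
  rw [hmean, hvar] at hmap
  set V := ∑ i, c i ^ 2
  have hV : 0 ≤ V := Finset.sum_nonneg fun i _ => sq_nonneg _
  have h1 : ∫ x, |∑ i, c i * x i| ∂(gpi p) = ∫ t, |t| ∂(gaussianReal 0 V.toNNReal) := by
    rw [← hmap, integral_map (Measurable.aemeasurable (by fun_prop)) (by fun_prop)]
  have h2 : gaussianReal 0 V.toNNReal = (gaussianReal 0 1).map (fun t => √V * t) := by
    rw [gaussianReal_map_const_mul]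
    congr 1
    · simp
    · ext; simp [hV]
  rw [h1, h2, integral_map (by fun_prop) (by fun_prop)]
  simp_rw [abs_mul]
  rw [integral_const_mul, abs_of_nonneg (sqrt_nonneg _)]
  have h3 : √V ≤ 1 := by rw [Real.sqrt_le_one]; exact hc
  have h4 : 0 ≤ ∫ t, |t| ∂(gaussianReal 0 1) := integral_nonneg fun t => abs_nonneg t
  calc _ ≤ 1 * ∫ t, |t| ∂(gaussianReal 0 1) := by gcongr
    _ ≤ 0.8 := by rw [one_mul]; exact gauss_abs

lemma gauss_sq : ∫ t, t ^ 2 ∂(gaussianReal 0 1) = 1 := by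
  have h := variance_fun_id_gaussianReal (μ := 0) (v := 1)
  rw [variance_of_integral_eq_zero (by fun_prop) (by simp)] at h
  simpa using h

lemma gpi_sq {p : ℕ} (b : Fin p → ℝ) : Integrable (fun x : Fin p → ℝ => ∑ i, b i ^ 2 * x i ^ 2) (gpi p) ∧
    ∫ x, ∑ i, b i ^ 2 * x i ^ 2 ∂(gpi p) = ∑ i, b i ^ 2 := by
  have h0 : Integrable (fun t : ℝ => t ^ 2) (gaussianReal 0 1) :=
    (memLp_id_gaussianReal (μ := 0) (v := 1) 2).integrable_sq
  have h : ∀ i, Integrable (fun x : Fin p → ℝ => b i ^ 2 * x i ^ 2) (gpi p) := fun i =>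
    ((measurePreserving_eval (fun _ : Fin p => gaussianReal 0 1) i).integrable_comp_of_integrable h0).const_mul _
  refine ⟨integrable_finsetSum _ fun i _ => h i, ?_⟩
  rw [integral_finsetSum _ fun i _ => h i]
  refine Finset.sum_congr rfl fun i _ => ?_
  rw [integral_const_mul, integral_comp_eval (μ := fun _ : Fin p => gaussianReal 0 1) (i := i) (f := fun t : ℝ => t ^ 2) (by fun_prop), gauss_sq, mul_one]

lemma event_prob {p : ℕ} (b c : Fin p → ℝ) (q κ : ℝ) (hq : q = ∑ i, b i ^ 2) (hq1 : 1 ≤ q)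
    (hκ : √q ≤ κ) (hc : ∑ i, c i ^ 2 ≤ 1) :
    ENNReal.ofReal (1 / 8.4) ≤
      gpi p {x | ∑ i, b i ^ 2 * x i ^ 2 + 2 * κ * |∑ i, c i * x i| ≤ q + 2 * κ * √q} := by
  set f : (Fin p → ℝ) → ℝ := fun x => ∑ i, b i ^ 2 * x i ^ 2 + 2 * κ * |∑ i, c i * x i| with hf
  have hs1 : 1 ≤ √q := by rw [Real.one_le_sqrt]; exact hq1
  have hs2 : √q ^ 2 = q := Real.sq_sqrt (by linarith)
  have hκ0 : 0 < κ := by linarith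
  obtain ⟨hi1, hi2⟩ := gpi_sq b
  have hi3 : Integrable (fun x : Fin p → ℝ => |∑ i, c i * x i|) (gpi p) :=
    (integrable_finsetSum _ fun i _ => (gpi_lin_integrable i).const_mul _).abs
  have hfi : Integrable f (gpi p) := hi1.add (hi3.const_mul _)
  have hfm : Measurable f := by fun_prop
  have hfint : ∫ x, f x ∂(gpi p) ≤ q + 2 * κ * 0.8 := by
    rw [hf, integral_add hi1 (hi3.const_mul _), hi2, ← hq, integral_const_mul]
    have := gpi_abs c hc
    gcongr
  have hR : 0 < q + 2 * κ * √q := by positivity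
  have hM := mul_meas_ge_le_integral_of_nonneg (μ := gpi p) (f := f)
    (ae_of_all _ fun x => by simp only [hf, Pi.zero_apply]; positivity) hfi (q + 2 * κ * √q)
  set r := (gpi p).real {x | q + 2 * κ * √q ≤ f x} with hr
  have hr1 : r ≤ 0.88 := by
    have h1 : (q + 2 * κ * √q) * r ≤ q + 2 * κ * 0.8 := hM.trans hfint
    have h2 : q + 2 * κ * 0.8 ≤ (q + 2 * κ * √q) * 0.88 := by
      set s := √q
      rw [← hs2]
      nlinarith [mul_nonneg (sub_nonneg.2 hκ) (sub_nonneg.2 hs1), mul_nonneg (by linarith : 0 ≤ s) (sub_nonneg.2 hs1), mul_nonneg (sub_nonneg.2 hκ) (by linarith : 0 ≤ s)]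
    exact le_of_mul_le_mul_left (h1.trans h2) hR
  have hms : MeasurableSet {x | f x ≤ q + 2 * κ * √q} := hfm measurableSet_Iic
  have hcompl : (gpi p).real {x | f x ≤ q + 2 * κ * √q} ≥ 0.12 := by
    have h1 := probReal_compl_eq_one_sub (μ := gpi p) hms
    have h2 : (gpi p).real {x | f x ≤ q + 2 * κ * √q}ᶜ ≤ r := by
      rw [hr]
      refine measureReal_mono ?_
      intro x hx
      simp only [Set.mem_compl_iff, Set.mem_ofPred_eq, not_le] at hx
      exact hx.le
    linarith
  rw [← ofReal_measureReal (μ := gpi p)]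
  apply ENNReal.ofReal_le_ofReal
  refine le_trans ?_ hcompl
  norm_num

lemma mix_lower {p : ℕ} (b h : Fin p → ℝ) (q κ m g y : ℝ) (hb : ∀ i, b i ^ 2 ≤ 1)
    (hq : q = ∑ i, b i ^ 2) (hq1 : 1 ≤ q)
    (hκ : √q ≤ κ) (hm : 0 < m) (hg : m * (√q + κ) ≤ g) (hy : 0 < y) (hh : y ^ 2 ≤ ∑ i, h i ^ 2) :
    ENNReal.ofReal (exp (m * κ * y - κ ^ 2 / 2)) * ENNReal.ofReal (1 / 8.4) ≤
      ∫⁻ x, {x : Fin p → ℝ | ∑ i, (m * b i * x i) ^ 2 ≤ g ^ 2}.indicator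
        (fun x => ENNReal.ofReal (exp (m * ∑ i, x i * h i))) x ∂(gpi p) := by
  have hs1 : 1 ≤ √q := by rw [Real.one_le_sqrt]; exact hq1
  have hs2 : √q ^ 2 = q := Real.sq_sqrt (by linarith)
  have hκ0 : 0 < κ := by linarith
  set N := √(∑ i, h i ^ 2) with hN
  have hN2 : N ^ 2 = ∑ i, h i ^ 2 := Real.sq_sqrt (by positivity)
  have hyN : y ≤ N := Real.le_sqrt_of_sq_le hh
  have hN0 : 0 < N := by linarith
  set u : Fin p → ℝ := fun i => h i / N with hu
  have hu2 : ∑ i, u i ^ 2 = 1 := by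
    simp only [hu, div_pow]
    rw [← Finset.sum_div, ← hN2, div_self (by positivity)]
  have huh : ∑ i, u i * h i = N := by
    have : ∀ i, u i * h i = h i ^ 2 / N := fun i => by simp only [hu]; ring
    simp_rw [this]
    rw [← Finset.sum_div, ← hN2]; field_simp
  set a : Fin p → ℝ := fun i => κ * u i with ha
  set c : Fin p → ℝ := fun i => b i ^ 2 * u i with hc
  have hc1 : ∑ i, c i ^ 2 ≤ 1 := by
    rw [← hu2]
    refine Finset.sum_le_sum fun i _ => ?_
    have h1 := hb i
    have h2 : (b i ^ 2) ^ 2 ≤ 1 := pow_le_one₀ (sq_nonneg _) h1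
    simp only [hc, mul_pow]
    nlinarith [sq_nonneg (u i)]
  set S : Set (Fin p → ℝ) := {x | ∑ i, (m * b i * x i) ^ 2 ≤ g ^ 2} with hS
  have hSm : MeasurableSet S := measurableSet_le (by fun_prop) (by fun_prop)
  set A : Set (Fin p → ℝ) := {x | ∑ i, b i ^ 2 * x i ^ 2 + 2 * κ * |∑ i, c i * x i| ≤ q + 2 * κ * √q}
    with hA
  have hAm : MeasurableSet A := measurableSet_le (by fun_prop) (by fun_prop)
  have hAS : ∀ x ∈ A, x + a ∈ S := by
    intro x hx
    simp only [hA, Set.mem_ofPred_eq] at hx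
    simp only [hS, Set.mem_ofPred_eq, Pi.add_apply]
    have e : ∑ i, (m * b i * (x i + a i)) ^ 2 = m ^ 2 * (∑ i, b i ^ 2 * x i ^ 2 +
        2 * κ * ∑ i, c i * x i + κ ^ 2 * ∑ i, b i ^ 2 * u i ^ 2) := by
      simp only [Finset.mul_sum, ← Finset.sum_add_distrib]
      refine Finset.sum_congr rfl fun i _ => ?_
      simp only [ha, hc]; ring
    have h1 : ∑ i, b i ^ 2 * u i ^ 2 ≤ 1 := by
      rw [← hu2]
      exact Finset.sum_le_sum fun i _ => by nlinarith [hb i, sq_nonneg (u i)]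
    have h2 := le_abs_self (∑ i, c i * x i)
    rw [e]
    calc _ ≤ m ^ 2 * (q + 2 * κ * √q + κ ^ 2 * 1) := by
            have h3 : 2 * κ * ∑ i, c i * x i ≤ 2 * κ * |∑ i, c i * x i| := by gcongr
            have h4 : κ ^ 2 * ∑ i, b i ^ 2 * u i ^ 2 ≤ κ ^ 2 * 1 := by gcongr
            exact mul_le_mul_of_nonneg_left (by linarith) (sq_nonneg m)
      _ = (m * (√q + κ)) ^ 2 := by
            conv_lhs => rw [← hs2]
            rw [hs2]; nlinarith
      _ ≤ g ^ 2 := by gcongr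
  set T : (Fin p → ℝ) → ℝ := fun x => ∑ i, (m * h i - a i) * x i with hT
  have hTneg : ∀ x, T (-x) = - T x := by
    intro x; simp [hT]
  have hAneg : ∀ x, x ∈ A → -x ∈ A := by
    intro x hx
    simp only [hA, Set.mem_ofPred_eq] at hx ⊢
    simpa using hx
  set G : (Fin p → ℝ) → ℝ≥0∞ := A.indicator (fun x => ENNReal.ofReal (exp (T x))) with hG
  have hGm : Measurable G := Measurable.indicator (by fun_prop) hAm
  -- symmetrization
  have hsym : gpi p A ≤ ∫⁻ x, G x ∂(gpi p) := by
    have h2 : 2 * gpi p A ≤ 2 * ∫⁻ x, G x ∂(gpi p) := by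
      calc 2 * gpi p A = ∫⁻ x, A.indicator (fun _ => (2 : ℝ≥0∞)) x ∂(gpi p) := by
            rw [lintegral_indicator hAm]; simp
        _ ≤ ∫⁻ x, (G x + G (-x)) ∂(gpi p) := by
            refine lintegral_mono fun x => ?_
            by_cases hx : x ∈ A
            · simp only [hG, Set.indicator_of_mem hx, Set.indicator_of_mem (hAneg x hx)]
              rw [hTneg, ← ENNReal.ofReal_add (exp_pos _).le (exp_pos _).le,
                ← ENNReal.ofReal_ofNat]
              apply ENNReal.ofReal_le_ofReal
              have := add_one_le_exp (T x)
              have := add_one_le_exp (-T x)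
              linarith
            · simp [Set.indicator_of_notMem hx]
        _ = 2 * ∫⁻ x, G x ∂(gpi p) := by
            rw [lintegral_add_left hGm, gpi_neg hGm, two_mul]
    exact (ENNReal.mul_le_mul_iff_right (by simp) (by simp)).1 h2
  have hev := (event_prob b c q κ hq hq1 hκ hc1).trans hsym
  rw [gpi_shift a (Measurable.indicator (by fun_prop) hSm)]
  calc _ ≤ ENNReal.ofReal (exp (m * κ * y - κ ^ 2 / 2)) * ∫⁻ x, G x ∂(gpi p) := by gcongr
    _ = ∫⁻ x, ENNReal.ofReal (exp (m * κ * y - κ ^ 2 / 2)) * G x ∂(gpi p) := by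
        rw [lintegral_const_mul _ hGm]
    _ ≤ _ := by
        refine lintegral_mono fun x => ?_
        by_cases hx : x ∈ A
        · simp only [hG, Set.indicator_of_mem hx, Set.indicator_of_mem (hAS x hx)]
          rw [← ENNReal.ofReal_mul (exp_pos _).le, ← ENNReal.ofReal_mul (exp_pos _).le, ← exp_add,
            ← exp_add]
          apply ENNReal.ofReal_le_ofReal
          apply exp_le_exp.2
          have e1 : ∑ i, a i ^ 2 = κ ^ 2 := by
            simp only [ha, mul_pow, ← Finset.mul_sum, hu2, mul_one]
          have e2 : m * ∑ i, (x + a) i * h i = T x + ∑ i, a i * x i + m * κ * N := by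
            rw [← huh]
            simp only [hT, Finset.mul_sum, ← Finset.sum_add_distrib]
            refine Finset.sum_congr rfl fun i _ => ?_
            simp only [ha, Pi.add_apply]; ring
          rw [e1, e2]
          have : m * κ * y ≤ m * κ * N := by gcongr
          linarith
        · simp [hG, Set.indicator_of_notMem hx]

lemma core {Ω : Type*} [MeasurableSpace Ω] (P : Measure Ω) [IsProbabilityMeasure P]
    {p : ℕ} (X : Ω → Fin p → ℝ) (hX : ∀ i, AEMeasurable (fun ω => X ω i) P)
    (b : Fin p → ℝ) (q κ m g y : ℝ) (hb : ∀ i, b i ^ 2 ≤ 1)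
    (hmom : ∀ c : Fin p → ℝ, ∑ i, c i ^ 2 ≤ g ^ 2 →
      ∫⁻ ω, ENNReal.ofReal (exp (∑ i, c i * X ω i)) ∂P ≤ ENNReal.ofReal (exp ((∑ i, c i ^ 2) / 2)))
    (hq : q = ∑ i, b i ^ 2) (hq1 : 1 ≤ q)
    (hκ : √q ≤ κ) (hm : 0 < m) (hm1 : m < 1) (hg : m * (√q + κ) ≤ g) (hy : 0 < y) :
    P {ω | y ^ 2 ≤ ∑ i, (b i * X ω i) ^ 2} ≤
      ENNReal.ofReal (8.4 * exp (-(m * κ * y - κ ^ 2 / 2)) * ∏ i, (√(1 - m ^ 2 * b i ^ 2))⁻¹) := by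
  have hX' : AEMeasurable X P := aemeasurable_pi_lambda _ hX
  set S : Set (Fin p → ℝ) := {x | ∑ i, (m * b i * x i) ^ 2 ≤ g ^ 2} with hS
  have hSm : MeasurableSet S := measurableSet_le (by fun_prop) (by fun_prop)
  set K : (Fin p → ℝ) → (Fin p → ℝ) → ℝ≥0∞ := fun z x =>
    S.indicator (fun x => ENNReal.ofReal (exp (m * ∑ i, x i * (b i * z i)))) x with hK
  have hKm : Measurable (Function.uncurry K) := by
    have : Function.uncurry K = (Prod.snd ⁻¹' S).indicator (fun zx : (Fin p → ℝ) × (Fin p → ℝ) =>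
        ENNReal.ofReal (exp (m * ∑ i, zx.2 i * (b i * zx.1 i)))) := by
      ext ⟨z, x⟩
      simp only [Function.uncurry, hK, Set.indicator, Set.mem_preimage]
    rw [this]
    exact Measurable.indicator (by fun_prop) (measurable_snd hSm)
  set C := ENNReal.ofReal (exp (m * κ * y - κ ^ 2 / 2)) * ENNReal.ofReal (1 / 8.4) with hC
  have hF : AEMeasurable (fun ω => ∫⁻ x, K (X ω) x ∂(gpi p)) P :=
    (Measurable.lintegral_prod_right (f := K) hKm).comp_aemeasurable hX'
  have hKX : AEMeasurable (Function.uncurry fun ω x => K (X ω) x) (P.prod (gpi p)) := by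
    have : (Function.uncurry fun ω x => K (X ω) x) = Function.uncurry K ∘ (Prod.map X id) := by
      ext ⟨ω, x⟩; rfl
    rw [this]
    refine hKm.comp_aemeasurable ?_
    exact (hX'.comp_fst).prodMk (aemeasurable_id.comp_snd)
  have hmain : C * P {ω | y ^ 2 ≤ ∑ i, (b i * X ω i) ^ 2} ≤
      ∏ i, ENNReal.ofReal (√(1 - m ^ 2 * b i ^ 2))⁻¹ := by
    calc C * P {ω | y ^ 2 ≤ ∑ i, (b i * X ω i) ^ 2}
        ≤ C * P {ω | C ≤ ∫⁻ x, K (X ω) x ∂(gpi p)} := by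
          gcongr
          intro hω
          exact mix_lower b _ q κ m g y hb hq hq1 hκ hm hg hy hω
      _ ≤ ∫⁻ ω, ∫⁻ x, K (X ω) x ∂(gpi p) ∂P := mul_meas_ge_le_lintegral₀ hF C
      _ = ∫⁻ x, ∫⁻ ω, K (X ω) x ∂P ∂(gpi p) := lintegral_lintegral_swap hKX
      _ ≤ ∫⁻ x, ∏ i, ENNReal.ofReal (exp (m ^ 2 * b i ^ 2 * x i ^ 2 / 2)) ∂(gpi p) := by
          refine lintegral_mono fun x => ?_
          by_cases hx : x ∈ S
          · simp only [hK, Set.indicator_of_mem hx]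
            have := hmom (fun i => m * b i * x i) hx
            rw [← ENNReal.ofReal_prod_of_nonneg (fun i _ => (exp_pos _).le), ← exp_sum,
              ← Finset.sum_div]
            convert this using 5
            · rw [Finset.mul_sum]
              refine Finset.sum_congr rfl fun i _ => ?_
              ring
            · rename_i i
              ring
          · simp [hK, Set.indicator_of_notMem hx]
      _ = _ := by
          rw [gpi_lintegral_prod (fun i t => ENNReal.ofReal (exp (m ^ 2 * b i ^ 2 * t ^ 2 / 2)))
            (fun i => by fun_prop)]
          refine Finset.prod_congr rfl fun i _ => ?_
          refine gauss_sq_exp ?_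
          have h1 : m ^ 2 < 1 := by nlinarith
          nlinarith [hb i, sq_nonneg m, sq_nonneg (b i)]
  have hCpos : 0 < exp (m * κ * y - κ ^ 2 / 2) * (1 / 8.4) := by positivity
  rw [hC, ← ENNReal.ofReal_mul (exp_pos _).le, mul_comm,
    ← ENNReal.le_div_iff_mul_le (Or.inl (by simpa using hCpos)) (Or.inl (by simp)),
    ← ENNReal.ofReal_prod_of_nonneg (fun i _ => by positivity), ← ENNReal.ofReal_div_of_pos hCpos] at hmain
  refine hmain.trans (ENNReal.ofReal_le_ofReal (le_of_eq ?_))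
  rw [exp_neg]
  field_simp

lemma mat_facts {p : ℕ} (B : Matrix (Fin p) (Fin p) ℝ) (hB : B.IsHermitian) :
    Matrix.trace (B ^ 2) = ∑ i, hB.eigenvalues i ^ 2 ∧
    (∀ μ : ℝ, Matrix.det (1 - μ • B ^ 2) = ∏ i, (1 - μ * hB.eigenvalues i ^ 2)) ∧
    (∀ v, ‖mApp B v‖ ^ 2 = ∑ i, (hB.eigenvalues i * ⟪hB.eigenvectorBasis i, v⟫) ^ 2) := by
  set U : Matrix (Fin p) (Fin p) ℝ := (hB.eigenvectorUnitary : Matrix (Fin p) (Fin p) ℝ) with hU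
  have hUU : star U * U = 1 := (Matrix.mem_unitaryGroup_iff'.1 hB.eigenvectorUnitary.2)
  have hUU' : U * star U = 1 := (Matrix.mem_unitaryGroup_iff.1 hB.eigenvectorUnitary.2)
  set D : Matrix (Fin p) (Fin p) ℝ := Matrix.diagonal hB.eigenvalues with hD
  have hsp : B = U * D * star U := by
    have := hB.spectral_theorem
    rw [Unitary.conjStarAlgAut_apply] at this
    exact this
  have hD2 : D * D = Matrix.diagonal (fun i => hB.eigenvalues i ^ 2) := by
    rw [hD, Matrix.diagonal_mul_diagonal]; congr 1; ext i; ring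
  have hsp2 : B ^ 2 = U * (D * D) * star U := by
    calc B ^ 2 = (U * D * star U) * (U * D * star U) := by rw [pow_two, ← hsp]
      _ = U * D * (star U * U) * D * star U := by simp only [mul_assoc]
      _ = _ := by rw [hUU]; simp only [mul_assoc, one_mul]
  refine ⟨?_, ?_, ?_⟩
  · rw [hsp2, Matrix.trace_mul_comm, ← mul_assoc, hUU, one_mul, hD2, Matrix.trace_diagonal]
  · intro μ
    have : 1 - μ • B ^ 2 = U * (1 - μ • (D * D)) * star U := by
      rw [mul_sub, sub_mul, mul_one, hUU', hsp2]; simp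
    rw [this, Matrix.det_mul_comm, ← mul_assoc, hUU, one_mul, hD2]
    have h2 : (1 : Matrix (Fin p) (Fin p) ℝ) - μ • Matrix.diagonal (fun i => hB.eigenvalues i ^ 2)
        = Matrix.diagonal (fun i => 1 - μ * hB.eigenvalues i ^ 2) := by
      rw [← Matrix.diagonal_one, ← Matrix.diagonal_smul, Matrix.diagonal_sub]; rfl
    rw [h2, Matrix.det_diagonal]
  · intro v
    rw [← hB.eigenvectorBasis.sum_sq_norm_inner_right (mApp B v)]
    refine Finset.sum_congr rfl fun i _ => ?_
    have hs := Matrix.isSymmetric_toEuclideanLin_iff.mpr hB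
    have h1 : ⟪hB.eigenvectorBasis i, mApp B v⟫ = ⟪mApp B (hB.eigenvectorBasis i), v⟫ :=
      (hs _ _).symm
    have h2 : mApp B (hB.eigenvectorBasis i) = hB.eigenvalues i • hB.eigenvectorBasis i := by
      have := hB.mulVec_eigenvectorBasis i
      ext j
      exact congrFun this j
    rw [h1, h2, inner_smul_left, norm_eq_abs, sq_abs]; simp

lemma eig_facts {p : ℕ} (hp : 0 < p) (B : Matrix (Fin p) (Fin p) ℝ) (hB : B.IsHermitian)
    (hBmax : (⨆ i, (hB.pow 2).eigenvalues i) = 1) :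
    (∀ i, hB.eigenvalues i ^ 2 ≤ 1) ∧ 1 ≤ Matrix.trace (B ^ 2) := by
  have : Nonempty (Fin p) := ⟨⟨0, hp⟩⟩
  have hle : ∀ j, (hB.pow 2).eigenvalues j ≤ 1 := fun j => by
    rw [← hBmax]; exact le_ciSup (Set.finite_range _).bddAbove j
  constructor
  · intro i
    have h1 := hB.eigenvalues_mem_spectrum_real i
    have h2 : hB.eigenvalues i ^ 2 ∈ spectrum ℝ (B ^ 2) := spectrum.pow_mem_pow B 2 h1
    rw [(hB.pow 2).spectrum_real_eq_range_eigenvalues] at h2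
    obtain ⟨j, hj⟩ := h2
    rw [← hj]; exact hle j
  · have hps : (B ^ 2).PosSemidef := by
      have := Matrix.posSemidef_conjTranspose_mul_self B
      rwa [hB.eq, ← pow_two] at this
    obtain ⟨j, hj⟩ := exists_eq_ciSup_of_finite (f := (hB.pow 2).eigenvalues)
    rw [(hB.pow 2).trace_eq_sum_eigenvalues, ← hBmax, ← hj]
    exact Finset.single_le_sum (f := fun i => (hB.pow 2).eigenvalues i)
      (fun i _ => hps.eigenvalues_nonneg i) (Finset.mem_univ j)

set_option maxHeartbeats 1000000 in
/-- Corollary `CTxivqLDAB`, second part: under the sub-Gaussian moment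
condition on `ξ` with `g² ≥ 2𝚙` and `B` symmetric with `λ_max(B²) = 1`, for `x > x_c`:
`P(‖Bξ‖² ≥ 𝔷_c(x,B)) ≤ 8.4 e^{-x}` where `𝔷_c(x,B) = (y_c + 2(x-x_c)/γ_c)²` and
`γ_c = g w_c/(1+w_c)`. -/
theorem stmt9 {Ω : Type*} [MeasurableSpace Ω] (P : Measure Ω) [IsProbabilityMeasure P]
    {p : ℕ} (hp : 0 < p)
    (ξ : Ω → EuclideanSpace ℝ (Fin p)) (g : ℝ) (hg : 0 < g)
    (hmom : ∀ γ : EuclideanSpace ℝ (Fin p), ‖γ‖ ≤ g →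
      Integrable (fun ω => Real.exp ⟪γ, ξ ω⟫) P ∧
        Real.log (∫ ω, Real.exp ⟪γ, ξ ω⟫ ∂P) ≤ ‖γ‖ ^ 2 / 2)
    (B : Matrix (Fin p) (Fin p) ℝ) (hB : B.IsHermitian)
    (hBmax : (⨆ i, (hB.pow 2).eigenvalues i) = 1)
    (pB vB wc μc yc xc γc : ℝ)
    (hpB : pB = Matrix.trace (B ^ 2))
    (hg2 : 2 * pB ≤ g ^ 2)
    (hvB : vB = Real.sqrt (2 * Matrix.trace (B ^ 4)))
    (hwc_pos : 0 < wc)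
    (hwc : wc * (1 + wc) / Real.sqrt (1 + wc ^ 2) = g / Real.sqrt pB)
    (hμc : μc = min (wc ^ 2 / (1 + wc ^ 2)) (2 / 3))
    (hyc : yc = Real.sqrt ((1 + wc ^ 2) * pB))
    (hxc : xc = (μc * yc ^ 2 + Real.log (Matrix.det (1 - μc • B ^ 2))) / 2)
    (hγc : γc = g * wc / (1 + wc))
    (x : ℝ) (hx : xc < x) :
    P {ω | ‖mApp B (ξ ω)‖ ^ 2 ≥ (yc + 2 * (x - xc) / γc) ^ 2} ≤
      ENNReal.ofReal (8.4 * Real.exp (-x)) := by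
  obtain ⟨htr, hdet, hnorm⟩ := mat_facts B hB
  obtain ⟨hb, htr1⟩ := eig_facts hp B hB hBmax
  set b := hB.eigenvalues with hbdef
  set e := hB.eigenvectorBasis with he
  have hq1 : 1 ≤ pB := by rw [hpB]; exact htr1
  have hs1 : 1 ≤ √pB := by rw [Real.one_le_sqrt]; exact hq1
  have hs2 : √pB ^ 2 = pB := Real.sq_sqrt (by linarith)
  have hr0 : 0 < √(1 + wc ^ 2) := by positivity
  have hr2 : √(1 + wc ^ 2) ^ 2 = 1 + wc ^ 2 := Real.sq_sqrt (by positivity)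
  -- g in terms of wc
  have hgs : g = √pB * (wc * (1 + wc) / √(1 + wc ^ 2)) := by
    rw [hwc]; field_simp
  have hyc' : yc = √(1 + wc ^ 2) * √pB := by rw [hyc, Real.sqrt_mul (by positivity)]
  have hyc0 : 0 < yc := by rw [hyc']; positivity
  have hw1 : 1 ≤ wc := by
    by_contra! hlt
    have h1 : g ^ 2 * (1 + wc ^ 2) = pB * (wc * (1 + wc)) ^ 2 := by
      rw [hgs, mul_pow, div_pow, hr2, hs2]; field_simp
    have h2 : 2 * (1 + wc ^ 2) ≤ (wc * (1 + wc)) ^ 2 := by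
      have : pB * (2 * (1 + wc ^ 2)) ≤ pB * (wc * (1 + wc)) ^ 2 := by
        rw [← h1]; nlinarith [sq_nonneg wc]
      exact le_of_mul_le_mul_left this (by linarith)
    have h3 : wc * (1 + wc) < 1 + wc := by nlinarith
    have h4 : (wc * (1 + wc)) ^ 2 < (1 + wc) ^ 2 := by
      apply pow_lt_pow_left₀ h3 (by positivity) (by norm_num)
    nlinarith [sq_nonneg (1 - wc)]
  set μb := wc ^ 2 / (1 + wc ^ 2) with hμb
  have hμb1 : μb < 1 := by rw [hμb, div_lt_one (by positivity)]; linarith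
  have hμb2 : 1 / 2 ≤ μb := by
    rw [hμb, div_le_div_iff₀ (by norm_num) (by positivity)]; nlinarith
  have hμ1 : μc ≤ μb := by rw [hμc]; exact min_le_left _ _
  have hμ2 : μc ≤ 2 / 3 := by rw [hμc]; exact min_le_right _ _
  have hμ3 : 1 / 2 ≤ μc := by rw [hμc]; exact le_min hμb2 (by norm_num)
  have hμw : 1 ≤ μc * (1 + wc ^ 2) := by
    have h1 : (1 : ℝ) ≤ wc ^ 2 := one_le_pow₀ hw1
    calc (1 : ℝ) = 1 / 2 * (1 + 1) := by norm_num
      _ ≤ μc * (1 + wc ^ 2) := by gcongr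
  have hμ4 : μb / 2 ≤ μc := by linarith
  have hγ : γc = μb * yc := by
    rw [hγc, hgs, hyc', hμb]
    field_simp
    rw [hr2]
  have hμb0 : 0 ≤ μb := by linarith
  have hsμb : √μb = wc / √(1 + wc ^ 2) := by
    rw [hμb, Real.sqrt_div (by positivity), Real.sqrt_sq hwc_pos.le]
  have hgsum : g = √μb * √pB + μb * yc := by
    rw [← hγ, hγc, hsμb]
    have : √pB * (wc / √(1 + wc ^ 2)) = g / (1 + wc) := by
      rw [hgs]; field_simp
    rw [mul_comm, this]; field_simp
  have hγ0 : 0 < γc := by rw [hγc]; positivity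
  set m := √μc with hm
  have hm2 : m ^ 2 = μc := Real.sq_sqrt (by linarith)
  have hm0 : 0 < m := Real.sqrt_pos.2 (by linarith)
  have hm1 : m < 1 := by
    rw [hm, Real.sqrt_lt' one_pos]; linarith
  set κ := m * yc with hκ
  have hκs : √pB ≤ κ := by
    apply Real.sqrt_le_iff.2 ⟨by positivity, ?_⟩
    rw [hκ, mul_pow, hm2, hyc', mul_pow, hr2, hs2, ← mul_assoc]
    exact le_mul_of_one_le_left (by linarith) hμw
  have hmg : m * (√pB + κ) ≤ g := by
    rw [hgsum]
    have h1 : m ≤ √μb := Real.sqrt_le_sqrt hμ1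
    calc m * (√pB + κ) = m * √pB + m ^ 2 * yc := by rw [hκ]; ring
      _ ≤ √μb * √pB + μb * yc := by rw [hm2]; gcongr
  set t := 2 * (x - xc) / γc with ht
  have ht0 : 0 < t := div_pos (by linarith) hγ0
  -- moment condition in coordinates
  set X : Ω → Fin p → ℝ := fun ω i => ⟪e i, ξ ω⟫ with hXdef
  have hsum : ∀ (c : Fin p → ℝ) ω, ⟪∑ i, c i • e i, ξ ω⟫ = ∑ i, c i * X ω i := by
    intro c ω
    rw [sum_inner]
    simp [hXdef, inner_smul_left]
  have hnrm : ∀ c : Fin p → ℝ, ‖∑ i, c i • e i‖ ^ 2 = ∑ i, c i ^ 2 := by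
    intro c
    rw [← e.sum_sq_norm_inner_right]
    refine Finset.sum_congr rfl fun i _ => ?_
    rw [e.orthonormal.inner_right_fintype, norm_eq_abs, sq_abs]
  have hmom' : ∀ c : Fin p → ℝ, ∑ i, c i ^ 2 ≤ g ^ 2 →
      ∫⁻ ω, ENNReal.ofReal (exp (∑ i, c i * X ω i)) ∂P ≤
        ENNReal.ofReal (exp ((∑ i, c i ^ 2) / 2)) := by
    intro c hc
    obtain ⟨h1, h2⟩ := hmom (∑ i, c i • e i) (by
      rw [← hnrm] at hc
      exact le_of_sq_le_sq hc hg.le)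
    rw [hnrm] at h2
    simp only [hsum] at h1 h2
    rw [← ofReal_integral_eq_lintegral_ofReal h1 (ae_of_all _ fun ω => (exp_pos _).le)]
    apply ENNReal.ofReal_le_ofReal
    have hpos : 0 < ∫ ω, exp (∑ i, c i * X ω i) ∂P := integral_exp_pos h1
    exact (Real.log_le_iff_le_exp hpos).1 h2
  have hXm : ∀ i, AEMeasurable (fun ω => X ω i) P := by
    intro i
    have hn : ‖g • e i‖ ≤ g := by
      rw [norm_smul, e.orthonormal.1 i, mul_one, norm_eq_abs, abs_of_pos hg]
    have h1 := (hmom (g • e i) hn).1.aestronglyMeasurable.aemeasurable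
    have h2 := (Real.measurable_log.comp_aemeasurable h1).const_mul g⁻¹
    refine h2.congr (ae_of_all _ fun ω => ?_)
    simp only [Function.comp, Real.log_exp, inner_smul_left, hXdef]
    simp
    field_simp
  have hfin := core P X hXm b pB κ m g (yc + t) hb hmom' (hpB.trans htr) hq1 hκs hm0 hm1 hmg
    (by linarith)
  have hset : {ω | ‖mApp B (ξ ω)‖ ^ 2 ≥ (yc + t) ^ 2} =
      {ω | (yc + t) ^ 2 ≤ ∑ i, (b i * X ω i) ^ 2} := by
    ext ω
    simp only [ge_iff_le, hnorm, hXdef, Set.mem_ofPred_eq]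
  rw [hset]
  refine hfin.trans (ENNReal.ofReal_le_ofReal ?_)
  have hpos : ∀ i, 0 < 1 - μc * b i ^ 2 := fun i => by
    have h1 : μc * b i ^ 2 ≤ 2 / 3 * 1 :=
      mul_le_mul hμ2 (hb i) (sq_nonneg _) (by norm_num)
    linarith
  have hprod : ∏ i, (√(1 - m ^ 2 * b i ^ 2))⁻¹ =
      exp (-(Real.log (Matrix.det (1 - μc • B ^ 2)) / 2)) := by
    rw [hdet, Real.log_prod (fun i _ => (hpos i).ne'), Finset.sum_div, ← Finset.sum_neg_distrib,
      exp_sum]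
    refine Finset.prod_congr rfl fun i _ => ?_
    rw [hm2, exp_neg, ← Real.log_sqrt (hpos i).le, Real.exp_log (Real.sqrt_pos.2 (hpos i))]
  rw [hprod, mul_assoc, ← exp_add]
  gcongr
  have hx' : x = xc + γc * t / 2 := by rw [ht]; field_simp; ring
  have h1 : m * κ * (yc + t) = μc * yc ^ 2 + μc * yc * t := by
    rw [hκ, ← hm2]; ring
  have h2 : κ ^ 2 = μc * yc ^ 2 := by rw [hκ, ← hm2]; ring
  have h3 : γc * t / 2 ≤ μc * yc * t := by
    rw [hγ]
    have : μb / 2 * (yc * t) ≤ μc * (yc * t) := by gcongr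
    linarith
  rw [h1, h2, hx', hxc]
  linarith
end
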